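/- arXiv:1309.2749 — 5 statements merged into one kernel-verified Lean document; each statement's English description precedes it below -/
import Mathlib

section
/- The Petersen graph and the Heawood graph are unichord-free. -/
open SimpleGraph

/-- An edge `e` of `G` is a chord of the cycle `c` if it joins two vertices of `c`
but is not an edge of `c`. -/
def IsChord {V : Type} (G : SimpleGraph V) {v : V} (c : G.Walk v v) (e : Sym2 V) : Prop :=
  e ∈ G.edgeSet ∧ e ∉ c.edges ∧ ∀ x ∈ e, x ∈ c.support

/-- A graph is unichord-free if no cycle has a unique chord. -/
def UnichordFree {V : Type} (G : SimpleGraph V) : Prop :=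
  ∀ (v : V) (c : G.Walk v v), c.IsCycle → ¬ ∃! e : Sym2 V, IsChord G c e

/-- `G` contains a square, i.e. an induced cycle on four vertices. -/
def HasSquare {V : Type} (G : SimpleGraph V) : Prop :=
  ∃ a b c d : V, G.Adj a b ∧ G.Adj b c ∧ G.Adj c d ∧ G.Adj d a ∧
    ¬ G.Adj a c ∧ ¬ G.Adj b d ∧ a ≠ c ∧ b ≠ d

/-- A total colouring: adjacent vertices, adjacent edges, and incident
vertex-edge pairs get different colours. -/
def IsTotalColouring {V α : Type} (G : SimpleGraph V) (fv : V → α) (fe : Sym2 V → α) : Prop :=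
  (∀ u v, G.Adj u v → fv u ≠ fv v) ∧
  (∀ e₁ e₂, e₁ ∈ G.edgeSet → e₂ ∈ G.edgeSet → e₁ ≠ e₂ → (∃ x, x ∈ e₁ ∧ x ∈ e₂) →
    fe e₁ ≠ fe e₂) ∧
  (∀ x e, e ∈ G.edgeSet → x ∈ e → fv x ≠ fe e)

/-- `G` admits a total colouring with `k` colours. -/
def TotalColourable {V : Type} (G : SimpleGraph V) (k : ℕ) : Prop :=
  ∃ (fv : V → Fin k) (fe : Sym2 V → Fin k), IsTotalColouring G fv fe

/-- A proper edge colouring with `k` colours. -/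
def EdgeColourable {V : Type} (G : SimpleGraph V) (k : ℕ) : Prop :=
  ∃ fe : Sym2 V → ℕ, (∀ e ∈ G.edgeSet, fe e < k) ∧
    ∀ e₁ e₂, e₁ ∈ G.edgeSet → e₂ ∈ G.edgeSet → e₁ ≠ e₂ → (∃ x, x ∈ e₁ ∧ x ∈ e₂) →
      fe e₁ ≠ fe e₂

/-- Two-connectivity: at least three vertices and deleting any single vertex
leaves a connected graph. -/
def TwoConnected {V : Type} (G : SimpleGraph V) : Prop :=
  3 ≤ (Set.univ : Set V).ncard ∧ ∀ v : V, (G.induce ({v}ᶜ : Set V)).Connected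

/-- A graph is sparse if its vertices of degree at least 3 form an independent set. -/
def Sparse {V : Type} (G : SimpleGraph V) : Prop :=
  ∀ u v, G.Adj u v → ¬ (3 ≤ (G.neighborSet u).ncard ∧ 3 ≤ (G.neighborSet v).ncard)

/-- `G` is a cycle graph. -/
def IsCycleGraph {V : Type} (G : SimpleGraph V) : Prop :=
  G.Connected ∧ ∀ v : V, (G.neighborSet v).ncard = 2

/-- The Petersen graph: outer 5-cycle `a`, inner pentagram `b`, spokes `aᵢbᵢ`. -/
def petersen : SimpleGraph (Fin 5 ⊕ Fin 5) :=
  SimpleGraph.fromRel (fun x y => match x, y with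
    | Sum.inl i, Sum.inl j => j = i + 1
    | Sum.inr i, Sum.inr j => j = i + 2
    | Sum.inl i, Sum.inr j => i = j
    | Sum.inr _, Sum.inl _ => False)

/-- The Heawood graph: a 14-cycle together with the seven standard chords. -/
def heawood : SimpleGraph (Fin 14) :=
  SimpleGraph.fromRel (fun i j => j = i + 1 ∨
    (i, j) ∈ ([((0 : Fin 14), (9 : Fin 14)), (1, 6), (2, 11), (3, 8), (4, 13), (5, 10),
      (7, 12)] : List (Fin 14 × Fin 14)))

/-- Subdivide the edge `uv` of `G`: the new vertex is `Sum.inr ()`. -/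
def SubdivideEdge {V : Type} (G : SimpleGraph V) (u v : V) : SimpleGraph (V ⊕ Unit) :=
  SimpleGraph.fromRel (fun x y => match x, y with
    | Sum.inl a, Sum.inl b => G.Adj a b ∧ ¬ (s(a, b) = s(u, v))
    | Sum.inl a, Sum.inr _ => a = u ∨ a = v
    | Sum.inr _, Sum.inl _ => False
    | Sum.inr _, Sum.inr _ => False)

/-- `G` is obtained from `H` (up to isomorphism) by repeatedly subdividing edges
incident to at least one vertex of degree 2. -/
inductive IsSubdivisionOf : {W : Type} → SimpleGraph W → {U : Type} → SimpleGraph U → Prop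
  | refl : ∀ {W : Type} (H : SimpleGraph W) {U : Type} (G : SimpleGraph U),
      (G ≃g H) → IsSubdivisionOf H G
  | step : ∀ {W : Type} (H : SimpleGraph W) {U : Type} (G : SimpleGraph U) (u v : U),
      G.Adj u v → ((G.neighborSet u).ncard = 2 ∨ (G.neighborSet v).ncard = 2) →
      IsSubdivisionOf H G → ∀ {U' : Type} (G' : SimpleGraph U'),
      (G' ≃g SubdivideEdge G u v) → IsSubdivisionOf H G'

/-- A 2-extension of `H`: first delete a set `S` of vertices of `H`, then
subdivide edges incident to at least one vertex of degree 2. -/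
def IsTwoExtensionOf {W U : Type} (H : SimpleGraph W) (G : SimpleGraph U) : Prop :=
  ∃ S : Set W, IsSubdivisionOf (H.induce Sᶜ) G

/-- `G'` is the reduced graph of `G`: every branch of `G'` has length at most 2
(no degree-2 vertex has a neighbour of degree 2) and `G` is obtained from `G'`
by subdividing edges incident to degree-2 vertices. -/
def IsReducedGraphOf {W U : Type} (G' : SimpleGraph W) (G : SimpleGraph U) : Prop :=
  (∀ v : W, (G'.neighborSet v).ncard = 2 →
    ∀ w ∈ G'.neighborSet v, 3 ≤ (G'.neighborSet w).ncard) ∧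
  IsSubdivisionOf G' G

/-- There is an `ab`-path of `G` all of whose vertices lie in `S`. -/
def ContainsPathBetween {V : Type} (G : SimpleGraph V) (S : Set V) (a b : V) : Prop :=
  ∃ p : G.Walk a b, p.IsPath ∧ ∀ v ∈ p.support, v ∈ S

/-- The subgraph of `G` induced by `S` is precisely an `ab`-path. -/
def InducedIsPathGraph {V : Type} (G : SimpleGraph V) (S : Set V) (a b : V) : Prop :=
  ∃ p : G.Walk a b, p.IsPath ∧ (∀ v, v ∈ S ↔ v ∈ p.support) ∧
    ∀ u v, u ∈ S → v ∈ S → G.Adj u v → s(u, v) ∈ p.edges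

/-- `(X, Y, a, b)` is a split of a proper 2-cutset of `G`. -/
structure IsProper2CutsetSplit {V : Type} (G : SimpleGraph V) (X Y : Set V) (a b : V) :
    Prop where
  hne : a ≠ b
  hnadj : ¬ G.Adj a b
  hcover : ∀ v, v ∈ X ∨ v ∈ Y ∨ v = a ∨ v = b
  hdisj : Disjoint X Y
  haX : a ∉ X
  haY : a ∉ Y
  hbX : b ∉ X
  hbY : b ∉ Y
  hX2 : 2 ≤ X.ncard
  hY2 : 2 ≤ Y.ncard
  hsep : ∀ x ∈ X, ∀ y ∈ Y, ¬ G.Adj x y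
  hXpath : ContainsPathBetween G (X ∪ {a, b}) a b
  hXnotpath : ¬ InducedIsPathGraph G (X ∪ {a, b}) a b
  hYpath : ContainsPathBetween G (Y ∪ {a, b}) a b
  hYnotpath : ¬ InducedIsPathGraph G (Y ∪ {a, b}) a b

/-- `G` has a proper 2-cutset. -/
def HasProper2Cutset {V : Type} (G : SimpleGraph V) : Prop :=
  ∃ (a b : V) (X Y : Set V), IsProper2CutsetSplit G X Y a b

/-- `G` has a 1-cutset (a cutvertex) with split `(X, Y, v)`. -/
def Has1Cutset {V : Type} (G : SimpleGraph V) : Prop :=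
  ∃ (v : V) (X Y : Set V), X.Nonempty ∧ Y.Nonempty ∧ Disjoint X Y ∧ v ∉ X ∧ v ∉ Y ∧
    (∀ w, w ∈ X ∨ w ∈ Y ∨ w = v) ∧ ∀ x ∈ X, ∀ y ∈ Y, ¬ G.Adj x y

/-- `(X, Y, A, B)` is a split of a proper 1-join of `G`. -/
structure IsProper1JoinSplit {V : Type} (G : SimpleGraph V) (X Y A B : Set V) : Prop where
  hcover : ∀ v, v ∈ X ∨ v ∈ Y
  hdisj : Disjoint X Y
  hAX : A ⊆ X
  hBY : B ⊆ Y
  hA2 : 2 ≤ A.ncard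
  hB2 : 2 ≤ B.ncard
  hAstable : ∀ u ∈ A, ∀ v ∈ A, ¬ G.Adj u v
  hBstable : ∀ u ∈ B, ∀ v ∈ B, ¬ G.Adj u v
  hcomplete : ∀ u ∈ A, ∀ v ∈ B, G.Adj u v
  hother : ∀ u ∈ X, ∀ v ∈ Y, G.Adj u v → u ∈ A ∧ v ∈ B

/-- `G` has a proper 1-join. -/
def HasProper1Join {V : Type} (G : SimpleGraph V) : Prop :=
  ∃ X Y A B : Set V, IsProper1JoinSplit G X Y A B

namespace SimpleGraph

variable {V : Type} [DecidableEq V]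

/-- Where `nbr` lists the neighbours of each vertex of a graph, the vertices satisfying `s` induce
a subgraph containing `u` and `v`, in which `u` and `v` have degree three and all other vertices
have degree two. -/
def IsCyclePlusChord (nbr : V → List V) (s : V → Bool) (u v : V) : Prop :=
  s u ∧ s v ∧ ∀ w, s w → (nbr w).countP s = if w = u ∨ w = v then 3 else 2

theorem forall_not_isCyclePlusChord_of_equiv {nbr : V → List V} {σ : V ≃ V}
    (hσ : ∀ w, nbr (σ w) = (nbr w).map σ) {u : V}
    (h : ∀ s, ∀ v ∈ nbr u, ¬ IsCyclePlusChord nbr s u v) (s : V → Bool) :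
    ∀ v ∈ nbr (σ u), ¬ IsCyclePlusChord nbr s (σ u) v := by
  rw [hσ, List.forall_mem_map]
  rintro v hv ⟨hu, hv', hdeg⟩
  refine h (s ∘ σ) v hv ⟨hu, hv', fun w hw => ?_⟩
  rw [← List.countP_map, ← hσ w, hdeg _ hw]
  simp only [EmbeddingLike.apply_eq_iff_eq]

theorem ncard_neighborSet_inter_support_of_unique_chord {G : SimpleGraph V} {a : V}
    {c : G.Walk a a} (hc : c.IsCycle) {u v : V} (huv : IsChord G c s(u, v))
    (huniq : ∀ e, IsChord G c e → e = s(u, v)) {w : V} (hw : w ∈ c.support) :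
    (G.neighborSet w ∩ {x | x ∈ c.support}).ncard = if w = u ∨ w = v then 3 else 2 := by
  obtain ⟨hadj, hnot, hmem⟩ := huv
  have hdeg := hc.ncard_neighborSet_toSubgraph_eq_two hw
  have hfin := c.finite_neighborSet_toSubgraph (w := w)
  have hinter : G.neighborSet w ∩ {x | x ∈ c.support} =
      c.toSubgraph.neighborSet w ∪ {x | s(w, x) = s(u, v)} := by
    ext x
    simp only [Set.mem_inter_iff, mem_neighborSet, Set.mem_ofPred_eq, Set.mem_union,
      Subgraph.mem_neighborSet, Walk.adj_toSubgraph_iff_mem_edges]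
    constructor
    · rintro ⟨hwx, hx⟩
      by_cases h : s(w, x) ∈ c.edges
      · exact .inl h
      · refine .inr (huniq _ ⟨hwx, h, ?_⟩)
        simp [hw, hx]
    · rintro (h | h)
      · exact ⟨c.adj_of_mem_edges h, c.snd_mem_support_of_mem_edges h⟩
      · constructor
        · rw [← mem_edgeSet, h]
          exact hadj
        · exact hmem x (h ▸ Sym2.mem_mk_right w x)
  have hinsert {y : V} (hy : s(w, y) = s(u, v)) :
      (G.neighborSet w ∩ {x | x ∈ c.support}).ncard = 3 := by
    have : {x | s(w, x) = s(u, v)} = {y} := by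
      ext x
      simp only [← hy, Set.mem_ofPred_eq, Set.mem_singleton_iff, Sym2.congr_right]
    rw [hinter, this, Set.union_singleton, Set.ncard_insert_of_notMem _ hfin, hdeg]
    rwa [Subgraph.mem_neighborSet, Walk.adj_toSubgraph_iff_mem_edges, hy]
  split_ifs with h
  · rcases h with rfl | rfl
    · exact hinsert rfl
    · exact hinsert Sym2.eq_swap
  · have : {x | s(w, x) = s(u, v)} = ∅ := by
      ext x
      simp
      grind
    rw [hinter, this, Set.union_empty, hdeg]

theorem unichordFree_of_forall_not_isCyclePlusChord {G : SimpleGraph V} {nbr : V → List V}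
    (hnodup : ∀ w, (nbr w).Nodup) (hnbr : ∀ w x, x ∈ nbr w ↔ G.Adj w x)
    (h : ∀ s u, ∀ v ∈ nbr u, ¬ IsCyclePlusChord nbr s u v) : UnichordFree G := by
  rintro a c hc ⟨e, he, huniq⟩
  induction e with | _ u v
  refine h (fun x => decide (x ∈ c.support)) u v ((hnbr u v).2 he.1)
    ⟨decide_eq_true (he.2.2 u (Sym2.mem_mk_left u v)),
      decide_eq_true (he.2.2 v (Sym2.mem_mk_right u v)), fun w hw => ?_⟩
  rw [← ncard_neighborSet_inter_support_of_unique_chord hc he huniq (of_decide_eq_true hw),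
    List.countP_eq_length_filter, ← List.toFinset_card_of_nodup ((hnodup w).filter _),
    ← Set.ncard_coe_finset]
  congr 1
  ext x
  simp [hnbr]

end SimpleGraph

/-- The neighbours of each vertex of the Petersen graph. -/
def petersenNbr : Fin 5 ⊕ Fin 5 → List (Fin 5 ⊕ Fin 5)
  | .inl i => [.inl (i + 1), .inl (i + 4), .inr i]
  | .inr i => [.inr (i + 2), .inr (i + 3), .inl i]

theorem nodup_petersenNbr : ∀ u, (petersenNbr u).Nodup := by
  decide

theorem mem_petersenNbr (u v : Fin 5 ⊕ Fin 5) : v ∈ petersenNbr u ↔ petersen.Adj u v := by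
  rcases u with i | i <;> rcases v with j | j <;>
    simp [petersenNbr, petersen] <;> revert i j <;> decide

theorem not_isCyclePlusChord_petersenNbr_inl_zero (s) : ∀ v ∈ petersenNbr (.inl 0),
    ¬ IsCyclePlusChord petersenNbr s (.inl 0) v := by
  rintro v hv ⟨hu, hv', h⟩
  simp only [petersenNbr, List.mem_cons, List.not_mem_nil, or_false] at hv
  rcases hv with rfl | rfl | rfl <;>
    simp +decide [Fin.forall_fin_succ, petersenNbr, List.countP_cons, hu, hv'] at h <;>
    grind

theorem not_isCyclePlusChord_petersenNbr_inr_zero (s) : ∀ v ∈ petersenNbr (.inr 0),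
    ¬ IsCyclePlusChord petersenNbr s (.inr 0) v := by
  rintro v hv ⟨hu, hv', h⟩
  simp only [petersenNbr, List.mem_cons, List.not_mem_nil, or_false] at hv
  rcases hv with rfl | rfl | rfl <;>
    simp +decide [Fin.forall_fin_succ, petersenNbr, List.countP_cons, hu, hv'] at h <;>
    grind

/-- The rotation of the Petersen graph by `k` steps. -/
abbrev petersenRotation (k : Fin 5) : Fin 5 ⊕ Fin 5 ≃ Fin 5 ⊕ Fin 5 :=
  Equiv.sumCongr (Equiv.addRight k) (Equiv.addRight k)

theorem petersenNbr_rotation : ∀ k w, petersenNbr (petersenRotation k w) =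
    (petersenNbr w).map (petersenRotation k) := by
  rintro k (i | i) <;> simp [petersenNbr, add_right_comm]

theorem not_isCyclePlusChord_petersenNbr (s u) : ∀ v ∈ petersenNbr u,
    ¬ IsCyclePlusChord petersenNbr s u v := by
  rcases u with i | i
  · simpa using forall_not_isCyclePlusChord_of_equiv (petersenNbr_rotation i)
      not_isCyclePlusChord_petersenNbr_inl_zero s
  · simpa using forall_not_isCyclePlusChord_of_equiv (petersenNbr_rotation i)
      not_isCyclePlusChord_petersenNbr_inr_zero s

/-- The neighbours of each vertex of the Heawood graph. -/
def heawoodNbr : Fin 14 → List (Fin 14) :=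
  ![[13, 1, 9], [0, 2, 6], [1, 3, 11], [2, 4, 8], [3, 5, 13], [4, 6, 10], [5, 7, 1],
    [6, 8, 12], [7, 9, 3], [8, 10, 0], [9, 11, 5], [10, 12, 2], [11, 13, 7], [12, 0, 4]]

theorem nodup_heawoodNbr : ∀ u, (heawoodNbr u).Nodup := by
  decide

theorem mem_heawoodNbr (u v : Fin 14) : v ∈ heawoodNbr u ↔ heawood.Adj u v := by
  simp only [heawood, fromRel_adj]
  revert u v
  decide +kernel

theorem not_isCyclePlusChord_heawoodNbr_zero (s) : ∀ v ∈ heawoodNbr 0,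
    ¬ IsCyclePlusChord heawoodNbr s 0 v := by
  rintro v hv ⟨hu, hv', h⟩
  change v ∈ [13, 1, 9] at hv
  simp only [List.mem_cons, List.not_mem_nil, or_false] at hv
  rcases hv with rfl | rfl | rfl <;>
    simp +decide [Fin.forall_fin_succ, heawoodNbr, List.countP_cons, hu, hv'] at h <;>
    grind

theorem not_isCyclePlusChord_heawoodNbr_one (s) : ∀ v ∈ heawoodNbr 1,
    ¬ IsCyclePlusChord heawoodNbr s 1 v := by
  rintro v hv ⟨hu, hv', h⟩
  change v ∈ [0, 2, 6] at hv
  simp only [List.mem_cons, List.not_mem_nil, or_false] at hv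
  rcases hv with rfl | rfl | rfl <;>
    simp +decide [Fin.forall_fin_succ, heawoodNbr, List.countP_cons, hu, hv'] at h <;>
    grind

/-- The rotation of the Heawood graph by `2 * k` steps. -/
abbrev heawoodRotation (k : Fin 14) : Fin 14 ≃ Fin 14 :=
  Equiv.addRight (2 * k)

theorem heawoodNbr_rotation : ∀ k w, heawoodNbr (heawoodRotation k w) =
    (heawoodNbr w).map (heawoodRotation k) := by
  decide +kernel

theorem exists_heawoodRotation : ∀ u, ∃ k, heawoodRotation k 0 = u ∨ heawoodRotation k 1 = u := by
  decide

theorem not_isCyclePlusChord_heawoodNbr (s u) : ∀ v ∈ heawoodNbr u,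
    ¬ IsCyclePlusChord heawoodNbr s u v := by
  obtain ⟨k, rfl | rfl⟩ := exists_heawoodRotation u
  · exact forall_not_isCyclePlusChord_of_equiv (heawoodNbr_rotation k)
      not_isCyclePlusChord_heawoodNbr_zero s
  · exact forall_not_isCyclePlusChord_of_equiv (heawoodNbr_rotation k)
      not_isCyclePlusChord_heawoodNbr_one s

/-- The Petersen graph and the Heawood graph are unichord-free. -/
theorem stmt6 : UnichordFree petersen ∧ UnichordFree heawood := by
  exact ⟨unichordFree_of_forall_not_isCyclePlusChord nodup_petersenNbr mem_petersenNbr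
      not_isCyclePlusChord_petersenNbr,
    unichordFree_of_forall_not_isCyclePlusChord nodup_heawoodNbr mem_heawoodNbr
      not_isCyclePlusChord_heawoodNbr⟩
end

section
/- Let G be a 2-connected {square,unichord}-free graph with a proper 2-cutset split (X,Y,a,b) chosen with |X| minimum over all such splits. Then a and b each have at least two neighbours in X. -/
open SimpleGraph

namespace SimpleGraph

variable {V : Type} {G : SimpleGraph V}

/-- A shortest walk is chordless. -/
theorem Walk.isChordless_of_length_eq_dist {u v : V} (p : G.Walk u v)
    (hp : p.length = G.dist u v) : p.IsChordless := by
  have hdist : ∀ i ≤ p.length, G.dist u (p.getVert i) = i := by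
    intro i hi
    have h₁ := dist_le (p.take i)
    have h₂ := dist_le (p.drop i)
    have h₃ := (p.take i).reachable.dist_triangle_left v
    rw [Walk.take_length] at h₁
    rw [Walk.drop_length] at h₂
    omega
  have hedge : ∀ i < p.length, s(p.getVert i, p.getVert (i + 1)) ∈ p.edges := by
    intro i hi
    exact (Walk.mk_mem_edges_iff_exists p).mpr ⟨i, hi, rfl⟩
  have key : ∀ i j, i ≤ p.length → j ≤ p.length → i ≤ j →
      G.Adj (p.getVert i) (p.getVert j) → s(p.getVert i, p.getVert j) ∈ p.edges := by
    intro i j hi hj hij h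
    have h₁ := (p.take i).reachable.dist_triangle_left (p.getVert j)
    rw [hdist i hi, hdist j hj, dist_eq_one_iff_adj.mpr h] at h₁
    have hne : i ≠ j := by
      rintro rfl
      exact h.ne rfl
    obtain rfl : j = i + 1 := by omega
    exact hedge i (by omega)
  rw [Walk.isChordless_iff_forall_mem_edges]
  intro x y hx hy h
  obtain ⟨i, rfl, hi⟩ := Walk.mem_support_iff_exists_getVert.mp hx
  obtain ⟨j, rfl, hj⟩ := Walk.mem_support_iff_exists_getVert.mp hy
  rcases le_total i j with hij | hij
  · exact key i j hi hj hij h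
  · rw [Sym2.eq_swap]
    exact key j i hj hi hij h.symm

theorem Reachable.exists_isPath_isChordless {u v : V} (h : G.Reachable u v) :
    ∃ p : G.Walk u v, p.IsPath ∧ p.IsChordless := by
  obtain ⟨p, hp⟩ := h.exists_walk_length_eq_dist
  exact ⟨p, p.isPath_of_length_eq_dist hp, p.isChordless_of_length_eq_dist hp⟩

theorem Walk.IsPath.append_of_forall {u v w : V} {p : G.Walk u v} {q : G.Walk v w}
    (hp : p.IsPath) (hq : q.IsPath) (h : ∀ x ∈ p.support, x ∈ q.support → x = v) :
    (p.append q).IsPath := by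
  have hq' := hq.support_nodup
  rw [Walk.isPath_def, Walk.support_append]
  rw [← Walk.cons_tail_support, List.nodup_cons] at hq'
  refine List.nodup_append'.mpr ⟨hp.support_nodup, hq'.2, fun x hx hx' => ?_⟩
  obtain rfl := h x hx (List.mem_of_mem_tail hx')
  exact hq'.1 hx'

/-- The graph formed by the edges of `G` with at least one end in `S`. -/
def edgesMeeting (G : SimpleGraph V) (S : Set V) : SimpleGraph V where
  Adj u v := G.Adj u v ∧ (u ∈ S ∨ v ∈ S)
  symm := ⟨fun _ _ h => ⟨h.1.symm, h.2.symm⟩⟩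
  loopless := ⟨fun _ h => h.1.ne rfl⟩

theorem edgesMeeting_le (S : Set V) : G.edgesMeeting S ≤ G := fun _ _ h => h.1

theorem Walk.mem_insert_of_edgesMeeting {S : Set V} {a b u v w : V}
    (hS : ∀ x ∈ S, ∀ y, G.Adj x y → y ∈ S ∪ {a, b}) (p : (G.edgesMeeting S).Walk u v)
    (hu : u ∈ S ∪ {a, b}) (hw : w ∈ p.support) : w ∈ S ∪ {a, b} := by
  induction p with
  | nil => exact (List.mem_singleton.mp hw) ▸ hu
  | @cons x y z h p ih =>
    rcases List.mem_cons.mp hw with rfl | hw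
    · exact hu
    · refine ih ?_ hw
      rcases h.2 with hx | hy
      · exact hS _ hx _ h.1
      · exact Or.inl hy

/-- In a 2-connected graph, a set `S` attached only to `a` and `b` has an edge to `a`,
and `a` can be reached from any vertex of `S` through `S`. -/
theorem _root_.TwoConnected.reachable_edgesMeeting (h2c : TwoConnected G) {S : Set V}
    {a b u : V} (hab : a ≠ b) (haS : a ∉ S) (hbS : b ∉ S)
    (hS : ∀ x ∈ S, ∀ y, G.Adj x y → y ∈ S ∪ {a, b}) (hu : u ∈ S) :
    (G.edgesMeeting S).Reachable u a ∧ ∃ w ∈ S, G.Adj w a := by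
  have key : ∀ s t : ({b}ᶜ : Set V), (G.induce ({b}ᶜ : Set V)).Walk s t → t.1 = a → s.1 ∈ S →
      (G.edgesMeeting S).Reachable s a ∧ ∃ w ∈ S, G.Adj w a := by
    intro s t p
    induction p with
    | nil => exact fun h h' => absurd (h ▸ h') haS
    | @cons x y z h p ih =>
      intro hz hx
      have hxy : G.Adj x.1 y.1 := h
      have hH : (G.edgesMeeting S).Adj x.1 y.1 := ⟨hxy, Or.inl hx⟩
      rcases hS _ hx _ hxy with hy | hy | hy
      · exact ⟨hH.reachable.trans (ih hz hy).1, (ih hz hy).2⟩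
      · rw [hy] at hH
        exact ⟨hH.reachable, x, hx, hH.1⟩
      · exact absurd hy y.2
  have hub : u ∈ ({b}ᶜ : Set V) := by
    rintro rfl
    exact hbS hu
  obtain ⟨p⟩ := (h2c.2 b).preconnected ⟨u, hub⟩ ⟨a, hab⟩
  exact key _ _ p rfl hu

theorem Walk.reachable_edgesMeeting {S : Set V} {a b u v : V} (hnadj : ¬ G.Adj a b)
    (p : G.Walk u v) (hp : ∀ w ∈ p.support, w ∈ S ∪ {a, b}) :
    (G.edgesMeeting S).Reachable u v := by
  induction p with
  | nil => exact Reachable.refl _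
  | @cons x y z h p ih =>
    have hx := hp x (by simp)
    have hy := hp y (by simp)
    have hH : (G.edgesMeeting S).Adj x y := by
      refine ⟨h, ?_⟩
      have := h.ne
      have := h.symm
      grind
    exact hH.reachable.trans (ih fun w hw => hp w (by simp [hw]))

end SimpleGraph

section

variable {V : Type} {G : SimpleGraph V}

theorem ContainsPathBetween.symm {S : Set V} {a b : V} (h : ContainsPathBetween G S a b) :
    ContainsPathBetween G S b a := by
  obtain ⟨p, hp, hS⟩ := h
  exact ⟨p.reverse, hp.reverse, by simpa using hS⟩

theorem InducedIsPathGraph.symm {S : Set V} {a b : V} (h : InducedIsPathGraph G S a b) :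
    InducedIsPathGraph G S b a := by
  obtain ⟨p, hp, hS, hc⟩ := h
  exact ⟨p.reverse, hp.reverse, by simpa using hS, by simpa using hc⟩

theorem InducedIsPathGraph.singleton (b : V) : InducedIsPathGraph G {b} b b :=
  ⟨.nil, .nil, by simp, by
    rintro u v rfl rfl h
    exact absurd rfl h.ne⟩

theorem InducedIsPathGraph.insert {S : Set V} {a x b : V} (h : InducedIsPathGraph G S x b)
    (ha : a ∉ S) (hax : G.Adj a x) (hS : ∀ v ∈ S, G.Adj a v → v = x) :
    InducedIsPathGraph G (insert a S) a b := by
  obtain ⟨p, hp, hpS, hc⟩ := h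
  refine ⟨.cons hax p, (Walk.cons_isPath_iff _ _).mpr ⟨hp, fun h => ha ((hpS a).mpr h)⟩,
    fun v => by simp [hpS], ?_⟩
  rintro u v (rfl | hu) (rfl | hv) huv
  · exact absurd rfl huv.ne
  · simp [hS v hv huv]
  · simp [hS u hu huv.symm]
  · simp [hc u v hu hv huv]

theorem InducedIsPathGraph.of_insert {S : Set V} {a x b : V}
    (h : InducedIsPathGraph G (Insert.insert x S) x b) (hx : x ∉ S) (hb : b ∈ S)
    (hS : ∀ v ∈ S, G.Adj x v → v = a) : InducedIsPathGraph G S a b := by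
  obtain ⟨p, hp, hpS, hc⟩ := h
  cases p with
  | nil => exact absurd hb hx
  | @cons _ y _ h p =>
    rw [Walk.cons_isPath_iff] at hp
    have hpS' : ∀ v, v ∈ S ↔ v ∈ p.support := by
      intro v
      have := hpS v
      simp only [Set.mem_insert_iff, Walk.support_cons, List.mem_cons] at this
      by_cases hv : v = x
      · subst hv
        exact iff_of_false hx hp.2
      · simpa [hv] using this
    obtain rfl := hS y ((hpS' y).mpr p.start_mem_support) h
    refine ⟨p, hp.1, hpS', fun u v hu hv huv => ?_⟩
    have := hc u v (Or.inr hu) (Or.inr hv) huv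
    rw [Walk.edges_cons, List.mem_cons, Sym2.eq_iff] at this
    grind

theorem IsProper2CutsetSplit.symm {X Y : Set V} {a b : V} (h : IsProper2CutsetSplit G X Y a b) :
    IsProper2CutsetSplit G X Y b a where
  hne := h.hne.symm
  hnadj := fun h' => h.hnadj h'.symm
  hcover := fun v => by have := h.hcover v; tauto
  hdisj := h.hdisj
  haX := h.hbX
  haY := h.hbY
  hbX := h.haX
  hbY := h.haY
  hX2 := h.hX2
  hY2 := h.hY2
  hsep := h.hsep
  hXpath := by rw [Set.pair_comm]; exact h.hXpath.symm
  hXnotpath := by rw [Set.pair_comm]; exact fun h' => h.hXnotpath h'.symm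
  hYpath := by rw [Set.pair_comm]; exact h.hYpath.symm
  hYnotpath := by rw [Set.pair_comm]; exact fun h' => h.hYnotpath h'.symm

/-- Two internally disjoint chordless paths, one from `x` to `b` through `S` and one from `a`
to `b` through `Y`, together with the edge `ax`, form a cycle whose only possible chord is
`xb`. -/
theorem UnichordFree.not_adj_of_paths (huf : UnichordFree G) {S Y : Set V} {a b x : V}
    (hax : G.Adj a x) (hnab : ¬ G.Adj a b) (hab : a ≠ b) (hxb : x ≠ b)
    (haS : a ∉ S) (hbS : b ∉ S) (hxS : x ∉ S) (haY : a ∉ Y) (hbY : b ∉ Y) (hxY : x ∉ Y)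
    (hSY : Disjoint S Y)
    (hS : ∀ u ∈ S, ∀ v, G.Adj u v → v ∈ S ∪ {x, b})
    (hY : ∀ u ∈ Y, ∀ v, G.Adj u v → v ∈ Y ∪ {a, b})
    (hrS : (G.edgesMeeting S).Reachable x b) (hrY : (G.edgesMeeting Y).Reachable a b) :
    ¬ G.Adj x b := by
  intro hadj
  obtain ⟨p, hp, hpc⟩ := hrS.exists_isPath_isChordless
  obtain ⟨q, hq, hqc⟩ := hrY.exists_isPath_isChordless
  have hps : ∀ w ∈ p.support, w ∈ S ∪ {x, b} := fun w hw =>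
    p.mem_insert_of_edgesMeeting hS (by simp) hw
  have hqs : ∀ w ∈ q.support, w ∈ Y ∪ {a, b} := fun w hw =>
    q.mem_insert_of_edgesMeeting hY (by simp) hw
  have hpe : ∀ u v, s(u, v) ∈ p.edges → u ∈ S ∨ v ∈ S := fun u v h =>
    (p.adj_of_mem_edges h).2
  have hqe : ∀ u v, s(u, v) ∈ q.edges → u ∈ Y ∨ v ∈ Y := fun u v h =>
    (q.adj_of_mem_edges h).2
  have hdis : ∀ w, w ∈ S → w ∉ Y := fun w h h' => Set.disjoint_left.mp hSY h h'
  let r := (p.mapLe (G.edgesMeeting_le S)).append (q.mapLe (G.edgesMeeting_le Y)).reverse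
  have hre : ∀ e, e ∈ r.edges ↔ e ∈ p.edges ∨ e ∈ q.edges := by
    intro e
    simp [r]
  have hrs : ∀ w, w ∈ r.support ↔ w ∈ p.support ∨ w ∈ q.support := by
    intro w
    simp [r, Walk.mem_support_append_iff]
  have hr : r.IsPath := by
    refine Walk.IsPath.append_of_forall ?_ ?_ ?_
    · exact (Walk.isPath_mapLe _).mpr hp
    · exact ((Walk.isPath_mapLe _).mpr hq).reverse
    · intro w hw hw'
      simp only [Walk.support_reverse, List.mem_reverse, Walk.support_mapLe_eq_support] at hw hw'
      have h₁ := hps w hw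
      have h₂ := hqs w hw'
      have := hax.ne
      grind
  have hcyc : (Walk.cons hax r).IsCycle := by
    refine (Walk.cons_isCycle_iff _ _).mpr ⟨hr, fun h => ?_⟩
    rcases (hre _).mp h with h | h
    · exact (hpe _ _ h).elim haS hxS
    · exact (hqe _ _ h).elim haY hxY
  have hsupp : ∀ w, w ∈ (Walk.cons hax r).support ↔ w ∈ p.support ∨ w ∈ q.support := by
    intro w
    have := q.start_mem_support
    rw [Walk.support_cons, List.mem_cons, hrs]
    grind
  refine huf a _ hcyc ⟨s(x, b), ⟨hadj, ?_, ?_⟩, ?_⟩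
  · rw [Walk.edges_cons, List.mem_cons, hre]
    rintro (h | h | h)
    · rw [Sym2.eq_iff] at h
      grind
    · exact (hpe _ _ h).elim hxS hbS
    · exact (hqe _ _ h).elim hxY hbY
  · intro w hw
    rw [hsupp]
    rcases Sym2.mem_iff.mp hw with rfl | rfl
    · exact Or.inl p.start_mem_support
    · exact Or.inl p.end_mem_support
  · intro e
    induction e with | _ u v
    rintro ⟨he, hne, hsup⟩
    have he : G.Adj u v := he
    have hu := (hsupp u).mp (hsup u (by simp))
    have hv := (hsupp v).mp (hsup v (by simp))
    rw [Walk.edges_cons, List.mem_cons, hre] at hne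
    push Not at hne
    have hpin : ∀ w, w ∈ p.support ∨ w ∈ q.support → w ∈ S ∪ {x, b} → w ∈ p.support := by
      rintro w hw (h | rfl | rfl)
      · refine hw.resolve_right fun hw => ?_
        rcases hqs w hw with h' | rfl | rfl
        exacts [hdis w h h', haS h, hbS h]
      · exact p.start_mem_support
      · exact p.end_mem_support
    have hqin : ∀ w, w ∈ p.support ∨ w ∈ q.support → w ∈ Y ∪ {a, b} → w ∈ q.support := by
      rintro w hw (h | rfl | rfl)
      · refine hw.resolve_left fun hw => ?_
        rcases hps w hw with h' | rfl | rfl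
        exacts [hdis w h' h, hxY h, hbY h]
      · exact q.start_mem_support
      · exact q.end_mem_support
    have hnS : ¬ (u ∈ S ∨ v ∈ S) := by
      intro h
      have hu' : u ∈ S ∪ {x, b} := h.elim Or.inl fun h => hS v h u he.symm
      have hv' : v ∈ S ∪ {x, b} := h.elim (fun h => hS u h v he) Or.inl
      exact hne.2.1 (hpc.mem_edges (hpin u hu hu') (hpin v hv hv') ⟨he, h⟩)
    have hnY : ¬ (u ∈ Y ∨ v ∈ Y) := by
      intro h
      have hu' : u ∈ Y ∪ {a, b} := h.elim Or.inl fun h => hY v h u he.symm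
      have hv' : v ∈ Y ∪ {a, b} := h.elim (fun h => hY u h v he) Or.inl
      exact hne.2.2 (hqc.mem_edges (hqin u hu hu') (hqin v hv hv') ⟨he, h⟩)
    have hend : ∀ w, w ∈ p.support ∨ w ∈ q.support → w ∉ S → w ∉ Y → w = x ∨ w = a ∨ w = b := by
      rintro w (hw | hw) hwS hwY
      · rcases hps w hw with h | h | h
        exacts [absurd h hwS, Or.inl h, Or.inr (Or.inr h)]
      · rcases hqs w hw with h | h | h
        exacts [absurd h hwY, Or.inr (Or.inl h), Or.inr (Or.inr h)]
    have hu' := hend u hu (fun h => hnS (Or.inl h)) (fun h => hnY (Or.inl h))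
    have hv' := hend v hv (fun h => hnS (Or.inr h)) (fun h => hnY (Or.inr h))
    have hne₁ := hne.1
    have h₁ := he.ne
    have h₂ := he.symm
    rw [Ne, Sym2.eq_iff] at hne₁
    rw [Sym2.eq_iff]
    clear hsup hne he hsupp hu hv hcyc hrs hre hr hps hqs hpe hqe hpin hqin hend hnS hnY
    rcases hu' with rfl | rfl | rfl <;> rcases hv' with rfl | rfl | rfl <;> simp_all

/-- If `a` has a unique neighbour `x` in `X`, moving `a` to `Y` and replacing it by `x` in the
cutset yields another proper 2-cutset split. -/
theorem IsProper2CutsetSplit.move [Fintype V] (h2c : TwoConnected G) (huf : UnichordFree G)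
    {X Y : Set V} {a b x : V} (h : IsProper2CutsetSplit G X Y a b) (hx : x ∈ X)
    (hax : G.Adj a x) (huniq : ∀ v ∈ X, G.Adj a v → v = x) :
    IsProper2CutsetSplit G (X \ {x}) (insert a Y) x b := by
  obtain ⟨hne, hnadj, hcover, hdisj, haX, haY, hbX, hbY, hX2, hY2, hsep, hXpath, hXnotpath,
    hYpath, hYnotpath⟩ := h
  have hxb : x ≠ b := by
    rintro rfl
    exact hbX hx
  have hxa : x ≠ a := hax.ne.symm
  have hdis : ∀ w, w ∈ X → w ∉ Y := fun w h h' => Set.disjoint_left.mp hdisj h h'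
  have hS : ∀ u ∈ X \ {x}, ∀ v, G.Adj u v → v ∈ (X \ {x}) ∪ {x, b} := by
    intro u hu v huv
    have h₁ := hcover v
    have h₂ := fun hv => hsep u hu.1 v hv huv
    have h₃ : v ≠ a := by
      rintro rfl
      exact hu.2 (huniq u hu.1 huv.symm)
    by_cases hvx : v = x <;> grind
  have hY : ∀ u ∈ Y, ∀ v, G.Adj u v → v ∈ Y ∪ {a, b} := by
    intro u hu v huv
    have h₁ := hcover v
    have h₂ := fun hv => hsep v hv u hu huv.symm
    grind
  have hxS : x ∉ X \ {x} := by simp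
  have haS : a ∉ X \ {x} := fun h => haX h.1
  have hbS : b ∉ X \ {x} := fun h => hbX h.1
  obtain ⟨x', hx', hx'x⟩ := Set.exists_ne_of_one_lt_ncard (s := X) (by omega) x
  have hx'S : x' ∈ X \ {x} := ⟨hx', hx'x⟩
  obtain ⟨hrx, y, hyS, hyx⟩ := h2c.reachable_edgesMeeting hxb hxS hbS hS hx'S
  obtain ⟨hrb, z, hzS, hzb⟩ := h2c.reachable_edgesMeeting hxb.symm hbS hxS
    (by rwa [Set.pair_comm]) hx'S
  have hxnb : ¬ G.Adj x b := by
    obtain ⟨q, -, hq⟩ := hYpath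
    exact huf.not_adj_of_paths hax hnadj hne hxb haS hbS hxS haY hbY (hdis x hx)
      (hdisj.mono_left Set.sdiff_subset) hS hY (hrx.symm.trans hrb)
      (q.reachable_edgesMeeting hnadj hq)
  have hXins : X ∪ {a, b} = insert a ((X \ {x}) ∪ {x, b}) := by
    ext v
    by_cases hv : v = x
    · subst hv
      simp [hx]
    · simp [hv]
  have hYins : insert a Y ∪ {x, b} = insert x (Y ∪ {a, b}) := by
    ext v
    simp
    tauto
  have hnot : ¬ InducedIsPathGraph G ((X \ {x}) ∪ {x, b}) x b := by
    intro hI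
    apply hXnotpath
    rw [hXins]
    refine hI.insert ?_ hax ?_
    · rintro (h | h | h)
      exacts [haS h, hxa h.symm, hne h]
    · rintro v (h | h | h) hav
      · exact huniq v h.1 hav
      · exact h
      · exact absurd (h ▸ hav) hnadj
  refine ⟨hxb, hxnb, ?_, ?_, hxS, ?_, hbS, ?_, ?_, ?_, ?_, ?_, hnot, ?_, ?_⟩
  · intro v
    have := hcover v
    by_cases hv : v = x
    · simp [hv]
    · simp [hv]
      tauto
  · rw [Set.disjoint_left]
    rintro v hv (rfl | hvY)
    exacts [haS hv, hdis v hv.1 hvY]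
  · rintro (h | h)
    exacts [hxa h, hdis x hx h]
  · rintro (h | h)
    exacts [hne h.symm, hbY h]
  · by_contra hlt
    have hsub : ∀ w ∈ X \ {x}, w = x' := fun w hw =>
      (Set.ncard_le_one (Set.toFinite _)).mp (by omega) w hw x' hx'S
    obtain rfl := hsub y hyS
    obtain rfl := hsub z hzS
    apply hnot
    have heq : X \ {x} ∪ {x, b} = insert x (insert z {b}) := by
      ext v
      have := hsub v
      simp only [Set.mem_union, Set.mem_insert_iff, Set.mem_singleton_iff]
      grind
    rw [heq]
    refine InducedIsPathGraph.insert (InducedIsPathGraph.insert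
      (InducedIsPathGraph.singleton b) ?_ hzb ?_) ?_ hyx.symm ?_
    · rintro rfl
      exact hbX hx'
    · exact fun v hv _ => hv
    · rintro (h | h)
      exacts [hx'x h.symm, hxb h]
    · rintro v (h | h) hxv
      · exact h
      · exact absurd (h ▸ hxv) hxnb
  · exact hY2.trans (Set.ncard_le_ncard (Set.subset_insert _ _))
  · rintro u hu v (rfl | hv) huv
    · exact hu.2 (huniq u hu.1 huv.symm)
    · exact hsep u hu.1 v hv huv
  · obtain ⟨q, hq⟩ := (hrx.symm.trans hrb).exists_isPath
    refine ⟨q.mapLe (G.edgesMeeting_le _), (Walk.isPath_mapLe _).mpr hq, fun v hv => ?_⟩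
    rw [Walk.support_mapLe_eq_support] at hv
    exact q.mem_insert_of_edgesMeeting hS (by simp) hv
  · obtain ⟨q, hq, hqs⟩ := hYpath
    rw [hYins]
    refine ⟨.cons hax.symm q, (Walk.cons_isPath_iff _ _).mpr ⟨hq, fun h => ?_⟩, ?_⟩
    · rcases hqs x h with h | h | h
      exacts [hdis x hx h, hxa h, hxb h]
    · intro v hv
      rcases List.mem_cons.mp hv with rfl | hv
      · exact Or.inl rfl
      · exact Or.inr (hqs v hv)
  · intro hI
    rw [hYins] at hI
    refine hYnotpath (hI.of_insert ?_ (by simp) ?_)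
    · rintro (h | h | h)
      exacts [hdis x hx h, hxa h, hxb h]
    · rintro v (h | h | h) hxv
      · exact absurd hxv (hsep x hx v h)
      · exact h
      · exact absurd (h ▸ hxv) hxnb

theorem IsProper2CutsetSplit.two_le_ncard_neighborSet_inter [Fintype V] (h2c : TwoConnected G)
    (huf : UnichordFree G) {X Y : Set V} {a b : V} (h : IsProper2CutsetSplit G X Y a b)
    (hmin : ∀ (X' Y' : Set V) (a' b' : V), IsProper2CutsetSplit G X' Y' a' b' →
      X.ncard ≤ X'.ncard) :
    2 ≤ (G.neighborSet a ∩ X).ncard := by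
  by_contra hlt
  obtain ⟨x, hx, hax⟩ : ∃ x ∈ X, G.Adj a x := by
    obtain ⟨p, -, hp⟩ := h.hXpath
    cases p with
    | nil => exact absurd rfl h.hne
    | @cons _ x _ hax p =>
      refine ⟨x, ?_, hax⟩
      rcases hp x (by simp) with hx | hx | hx
      · exact hx
      · exact absurd hx hax.ne.symm
      · exact absurd (hx ▸ hax) h.hnadj
  have huniq : ∀ v ∈ X, G.Adj a v → v = x := fun v hv hav =>
    (Set.ncard_le_one (Set.toFinite (G.neighborSet a ∩ X))).mp (by omega) v ⟨hav, hv⟩ x ⟨hax, hx⟩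
  exact absurd (hmin _ _ _ _ (h.move h2c huf hx hax huniq))
    (not_le.mpr (Set.ncard_sdiff_singleton_lt_of_mem hx))

end

/-- In a 2-connected {square,unichord}-free graph, for a proper 2-cutset split
`(X, Y, a, b)` with `|X|` minimum, both `a` and `b` have at least two
neighbours in `X`. -/
theorem stmt11 {V : Type} [Fintype V] (G : SimpleGraph V) (h2c : TwoConnected G)
    (hsq : ¬ HasSquare G) (huf : UnichordFree G) (X Y : Set V) (a b : V)
    (hsplit : IsProper2CutsetSplit G X Y a b)
    (hmin : ∀ (X' Y' : Set V) (a' b' : V), IsProper2CutsetSplit G X' Y' a' b' →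
      X.ncard ≤ X'.ncard) :
    2 ≤ (G.neighborSet a ∩ X).ncard ∧ 2 ≤ (G.neighborSet b ∩ X).ncard := by
  exact ⟨hsplit.two_le_ncard_neighborSet_inter h2c huf hmin,
    hsplit.symm.two_le_ncard_neighborSet_inter h2c huf hmin⟩
end

section
/- Let G be a 2-connected {square,unichord}-free graph with a proper 2-cutset split (X,Y,a,b). Then the block of decomposition G_X (obtained from G[X∪{a,b}] by adding a marker vertex c adjacent to a and b, unless such a degree-2 vertex already exists in X) is 2-connected, square-free and unichord-free. -/
open SimpleGraph

/-- The block `G_X` of a proper 2-cutset when a new marker vertex must be added: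
`Sum.inr ()` is the marker, adjacent exactly to `a` and `b`. -/
def BlockWithMarker {V : Type} (G : SimpleGraph V) (X : Set V) (a b : V) :
    SimpleGraph (↥(X ∪ {a, b}) ⊕ Unit) :=
  SimpleGraph.fromRel (fun x y => match x, y with
    | Sum.inl u, Sum.inl v => G.Adj u v
    | Sum.inl u, Sum.inr _ => (u : V) = a ∨ (u : V) = b
    | Sum.inr _, Sum.inl _ => False
    | Sum.inr _, Sum.inr _ => False)

/-- `u` and `v` are joined by a walk of `G` all of whose vertices lie in `S`. -/
def ConnIn {V : Type} (G : SimpleGraph V) (S : Set V) (u v : V) : Prop :=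
  ∃ p : G.Walk u v, ∀ x ∈ p.support, x ∈ S

namespace ConnIn

variable {V : Type} {G : SimpleGraph V} {S T : Set V} {u v w : V}

lemma refl (hu : u ∈ S) : ConnIn G S u u := ⟨.nil, by simpa using hu⟩

lemma symm (h : ConnIn G S u v) : ConnIn G S v u := by
  obtain ⟨p, hp⟩ := h
  exact ⟨p.reverse, by simpa using hp⟩

lemma trans (h : ConnIn G S u v) (h' : ConnIn G S v w) : ConnIn G S u w := by
  obtain ⟨p, hp⟩ := h
  obtain ⟨q, hq⟩ := h'
  refine ⟨p.append q, fun x hx => ?_⟩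
  rw [Walk.mem_support_append_iff] at hx
  exact hx.elim (hp x) (hq x)

lemma mono (h : ConnIn G S u v) (hST : S ⊆ T) : ConnIn G T u v := by
  obtain ⟨p, hp⟩ := h
  exact ⟨p, fun x hx => hST (hp x hx)⟩

lemma of_adj (h : G.Adj u v) (hu : u ∈ S) (hv : v ∈ S) : ConnIn G S u v :=
  ⟨h.toWalk, by simp [hu, hv]⟩

end ConnIn

/-- A walk inside `T` is transported by a map which preserves adjacency on `T`. -/
lemma exists_walk_map {W V : Type} {H : SimpleGraph W} {G : SimpleGraph V} (g : W → V)
    {T : Set W} (hadj : ∀ x ∈ T, ∀ y ∈ T, H.Adj x y → G.Adj (g x) (g y)) {u v : W}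
    (p : H.Walk u v) (hp : ∀ x ∈ p.support, x ∈ T) :
    ∃ q : G.Walk (g u) (g v), q.support = p.support.map g ∧
      q.edges = p.edges.map (Sym2.map g) := by
  induction p with
  | nil => exact ⟨.nil, by simp, by simp⟩
  | @cons u v w h p ih =>
    obtain ⟨q, hq, hq'⟩ := ih fun x hx => hp x (by simp [hx])
    exact ⟨.cons (hadj u (hp u (by simp)) v (hp v (by simp)) h) q, by simp [hq], by simp [hq']⟩

lemma ConnIn.map {W V : Type} {H : SimpleGraph W} {G : SimpleGraph V} (g : W → V)
    {T : Set W} {S : Set V} (hadj : ∀ x ∈ T, ∀ y ∈ T, H.Adj x y → G.Adj (g x) (g y))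
    (hTS : ∀ x ∈ T, g x ∈ S) {u v : W} (h : ConnIn H T u v) : ConnIn G S (g u) (g v) := by
  obtain ⟨p, hp⟩ := h
  obtain ⟨q, hq, -⟩ := exists_walk_map g hadj p hp
  refine ⟨q, fun x hx => ?_⟩
  rw [hq, List.mem_map] at hx
  obtain ⟨y, hy, rfl⟩ := hx
  exact hTS y (hp y hy)

lemma connected_induce_iff_connIn {V : Type} {G : SimpleGraph V} {S : Set V} :
    (G.induce S).Connected ↔ S.Nonempty ∧ ∀ u ∈ S, ∀ v ∈ S, ConnIn G S u v := by
  rw [connected_iff, and_comm, Set.nonempty_coe_sort]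
  refine and_congr_right fun _ => ⟨fun h u hu v hv => ?_, fun h u v => ?_⟩
  · obtain ⟨p⟩ := h ⟨u, hu⟩ ⟨v, hv⟩
    exact ConnIn.map (H := G.induce S) (T := Set.univ) Subtype.val (fun _ _ _ _ h => h)
      (fun x _ => x.2) ⟨p, fun _ _ => trivial⟩
  · obtain ⟨p, hp⟩ := h u u.2 v v.2
    exact ⟨p.induce S hp⟩

/-- A walk of minimum length inside `S` is a path. -/
lemma isPath_of_forall_length_le {V : Type} {G : SimpleGraph V} {S : Set V} {u v : V}
    (p : G.Walk u v) (hp : ∀ x ∈ p.support, x ∈ S)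
    (hmin : ∀ q : G.Walk u v, (∀ x ∈ q.support, x ∈ S) → p.length ≤ q.length) : p.IsPath := by
  classical
  rw [← p.bypass_eq_self_of_length_le_length_bypass
    (hmin _ fun x hx => hp x (p.support_bypass_subset_support hx))]
  exact p.bypass_isPath

/-- A walk of minimum length inside `S` is chordless. -/
lemma isChordless_of_forall_length_le {V : Type} {G : SimpleGraph V} {S : Set V} {u v : V}
    (p : G.Walk u v) (hp : ∀ x ∈ p.support, x ∈ S)
    (hmin : ∀ q : G.Walk u v, (∀ x ∈ q.support, x ∈ S) → p.length ≤ q.length) :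
    p.IsChordless := by
  rw [Walk.isChordless_iff_forall_mem_edges]
  have key : ∀ i j, i < j → j ≤ p.length → G.Adj (p.getVert i) (p.getVert j) →
      s(p.getVert i, p.getVert j) ∈ p.edges := by
    intro i j hij hj h
    have hlen := hmin ((p.take i).append (.cons h (p.drop j))) (by
      intro x hx
      rw [Walk.mem_support_append_iff, Walk.support_cons, List.mem_cons] at hx
      rcases hx with hx | rfl | hx
      · exact hp x ((p.isSubwalk_take i).support_subset hx)
      · exact hp _ (p.getVert_mem_support i)
      · exact hp x ((p.isSubwalk_drop j).support_subset hx))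
    simp only [Walk.length_append, Walk.take_length, Walk.length_cons, Walk.drop_length] at hlen
    have : j = i + 1 := by omega
    subst this
    rw [Walk.mk_mem_edges_iff_exists]
    exact ⟨i, by omega, rfl⟩
  intro x y hx hy h
  obtain ⟨i, rfl, hi⟩ := Walk.mem_support_iff_exists_getVert.mp hx
  obtain ⟨j, rfl, hj⟩ := Walk.mem_support_iff_exists_getVert.mp hy
  rcases lt_trichotomy i j with hij | rfl | hij
  · exact key i j hij hj h
  · exact absurd h (G.loopless.irrefl _)
  · rw [Sym2.eq_swap]
    exact key j i hij hi h.symm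

lemma ConnIn.exists_isPath_isChordless {V : Type} {G : SimpleGraph V} {S : Set V} {u v : V}
    (h : ConnIn G S u v) :
    ∃ p : G.Walk u v, p.IsPath ∧ p.IsChordless ∧ ∀ x ∈ p.support, x ∈ S := by
  classical
  have hex : ∃ n, ∃ p : G.Walk u v, (∀ x ∈ p.support, x ∈ S) ∧ p.length = n := by
    obtain ⟨p, hp⟩ := h
    exact ⟨_, p, hp, rfl⟩
  obtain ⟨p, hp, hlen⟩ := Nat.find_spec hex
  have hmin : ∀ q : G.Walk u v, (∀ x ∈ q.support, x ∈ S) → p.length ≤ q.length :=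
    fun q hq => hlen ▸ Nat.find_min' hex ⟨q, hq, rfl⟩
  exact ⟨p, isPath_of_forall_length_le p hp hmin, isChordless_of_forall_length_le p hp hmin, hp⟩

lemma isChord_iff {V : Type} {G : SimpleGraph V} {v : V} (c : G.Walk v v) (e : Sym2 V) :
    IsChord G c e ↔ c.IsChord e := by
  induction e with
  | _ x y => simp [IsChord, Walk.isChord_sym2Mk]

lemma sym2_map_injOn {W V : Type} {g : W → V} {T : Set W} (hg : Set.InjOn g T) :
    Set.InjOn (Sym2.map g) {e | ∀ x ∈ e, x ∈ T} := by
  intro e he e' he' h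
  induction e with
  | _ x y =>
    induction e' with
    | _ x' y' =>
      simp only [Set.mem_ofPred_eq, Sym2.mem_iff, forall_eq_or_imp, forall_eq] at he he'
      rw [Sym2.map_mk, Sym2.map_mk, Sym2.eq_iff] at h
      rcases h with ⟨h1, h2⟩ | ⟨h1, h2⟩
      · rw [hg he.1 he'.1 h1, hg he.2 he'.2 h2]
      · rw [hg he.1 he'.2 h1, hg he.2 he'.1 h2, Sym2.eq_swap]

/-- A map which is injective and preserves and reflects adjacency on `T` transports walks
inside `T` together with their chords. -/
lemma existsUnique_isChord_of_map {W V : Type} {H : SimpleGraph W} {G : SimpleGraph V} {g : W → V}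
    {T : Set W} (hadj : ∀ x ∈ T, ∀ y ∈ T, G.Adj (g x) (g y) ↔ H.Adj x y) (hg : Set.InjOn g T)
    {u v : W} {u' v' : V} {p : H.Walk u v} (hp : ∀ x ∈ p.support, x ∈ T) {q : G.Walk u' v'}
    (hs : q.support = p.support.map g) (he : q.edges = p.edges.map (Sym2.map g))
    (h : ∃! e, p.IsChord e) : ∃! e, q.IsChord e := by
  have hedge : ∀ x ∈ p.support, ∀ y ∈ p.support,
      s(g x, g y) ∈ q.edges ↔ s(x, y) ∈ p.edges := by
    intro x hx y hy
    rw [he, List.mem_map]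
    refine ⟨?_, fun h => ⟨_, h, rfl⟩⟩
    rintro ⟨e, hep, hex⟩
    rwa [← sym2_map_injOn hg (x₁ := e) (x₂ := s(x, y))
      (fun z hz => hp z (p.mem_support_of_mem_edges hep hz)) ?_ hex]
    intro z hz
    rcases Sym2.mem_iff.mp hz with rfl | rfl
    exacts [hp _ hx, hp _ hy]
  have hiff : ∀ x ∈ p.support, ∀ y ∈ p.support,
      q.IsChord s(g x, g y) ↔ p.IsChord s(x, y) := by
    intro x hx y hy
    have hx' : g x ∈ q.support := hs ▸ List.mem_map_of_mem hx
    have hy' : g y ∈ q.support := hs ▸ List.mem_map_of_mem hy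
    rw [Walk.isChord_sym2Mk, Walk.isChord_sym2Mk, hedge x hx y hy,
      hadj x (hp x hx) y (hp y hy)]
    simp [hx, hy, hx', hy']
  obtain ⟨e, hc, huniq⟩ := h
  refine ⟨e.map g, ?_, ?_⟩
  · induction e with
    | _ x y =>
      have h := Walk.isChord_sym2Mk.mp hc
      exact (hiff x h.2.2.1 y h.2.2.2).mpr hc
  · intro e' he'
    induction e' with
    | _ x' y' =>
      have h := Walk.isChord_sym2Mk.mp he'
      rw [hs, List.mem_map, List.mem_map] at h
      obtain ⟨-, -, ⟨x, hx, rfl⟩, ⟨y, hy, rfl⟩⟩ := h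
      rw [← huniq _ ((hiff x hx y hy).mp he'), Sym2.map_mk]

/-- In a unichord-free graph `G`, a cycle of `H` inside a part `T` which embeds into `G` has
no unique chord. -/
lemma UnichordFree.not_existsUnique_isChord {W V : Type} {H : SimpleGraph W} {G : SimpleGraph V}
    (hG : UnichordFree G) {g : W → V} {T : Set W}
    (hadj : ∀ x ∈ T, ∀ y ∈ T, G.Adj (g x) (g y) ↔ H.Adj x y) (hg : Set.InjOn g T)
    {v : W} {c : H.Walk v v} (hc : c.IsCycle) (hT : ∀ x ∈ c.support, x ∈ T) :
    ¬ ∃! e, c.IsChord e := by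
  intro h
  obtain ⟨q, hs, he⟩ := exists_walk_map g (fun x hx y hy h => (hadj x hx y hy).mpr h) c hT
  have hq := existsUnique_isChord_of_map hadj hg hT hs he h
  refine hG _ q ?_ (by simpa only [isChord_iff] using hq)
  rw [Walk.isCycle_def, Walk.isTrail_def, he, hs, ← List.map_tail]
  rw [Walk.isCycle_def, Walk.isTrail_def] at hc
  refine ⟨hc.1.map_on fun e hec e' hec' => ?_, ?_, hc.2.2.map_on fun x hx y hy => ?_⟩
  · exact @sym2_map_injOn _ _ g T hg e (fun z hz => hT z (c.mem_support_of_mem_edges hec hz)) e'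
      (fun z hz => hT z (c.mem_support_of_mem_edges hec' hz))
  · rintro rfl
    rw [Walk.edges_nil, eq_comm, List.map_eq_nil_iff, Walk.edges_eq_nil] at he
    exact hc.2.1 (Walk.eq_nil_iff_nil.mpr he)
  · exact @hg x (hT x (List.mem_of_mem_tail hx)) y (hT y (List.mem_of_mem_tail hy))

lemma UnichordFree.of_embedding {W V : Type} {H : SimpleGraph W} {G : SimpleGraph V}
    (hG : UnichordFree G) (f : H ↪g G) : UnichordFree H := by
  intro v c hc h
  simp only [isChord_iff] at h
  exact hG.not_existsUnique_isChord (g := f) (T := Set.univ) (fun _ _ _ _ => f.map_adj_iff)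
    f.injective.injOn hc (fun _ _ => trivial) h

lemma HasSquare.of_embedding {W V : Type} {H : SimpleGraph W} {G : SimpleGraph V}
    (f : H ↪g G) (h : HasSquare H) : HasSquare G := by
  obtain ⟨a, b, c, d, h1, h2, h3, h4, h5, h6, h7, h8⟩ := h
  exact ⟨f a, f b, f c, f d, by simpa using h1, by simpa using h2, by simpa using h3,
    by simpa using h4, by simpa using h5, by simpa using h6, by simpa using h7, by simpa using h8⟩

/-- Two common neighbours of a pair of non-adjacent vertices coincide. -/
lemma eq_of_common_neighbours {V : Type} {G : SimpleGraph V} (hsq : ¬ HasSquare G)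
    (huf : UnichordFree G) {a b w z : V} (hab : a ≠ b) (hnadj : ¬ G.Adj a b) (haw : G.Adj a w)
    (hbw : G.Adj b w) (haz : G.Adj a z) (hbz : G.Adj b z) : w = z := by
  by_contra hwz
  by_cases h : G.Adj w z
  · refine huf a (.cons haw (.cons hbw.symm (.cons hbz (.cons haz.symm .nil)))) ?_
      ⟨s(w, z), ?_, ?_⟩
    · have := haw.ne; have := hbw.ne; have := haz.ne; have := hbz.ne
      rw [Walk.cons_isCycle_iff]
      simp
      grind
    · have := haw.ne; have := hbw.ne; have := haz.ne; have := hbz.ne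
      simp [IsChord, h]
      grind
    · intro e he
      have hba : ¬ G.Adj b a := fun h => hnadj h.symm
      induction e with
      | _ x y =>
        simp only [IsChord, mem_edgeSet, Walk.edges_cons, Walk.edges_nil, List.mem_cons,
          Walk.support_cons, Walk.support_nil, Sym2.mem_iff, forall_eq_or_imp, forall_eq,
          Sym2.eq_iff] at he ⊢
        have := he.1.ne
        grind
  · exact hsq ⟨a, w, b, z, haw, hbw.symm, hbz, haz.symm, hnadj, h, hab, hwz⟩

/-- In a 2-connected graph, if `Z` has no neighbours outside `Z ∪ {a, b}`, then every vertex of `Z`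
other than `v` can reach, inside `Z \ {v}`, a neighbour of one of `a` and `b` other than `v`. -/
lemma TwoConnected.exists_connIn_adj {V : Type} {G : SimpleGraph V} (h2c : TwoConnected G)
    {Z : Set V} {a b : V} (hab : a ≠ b) (haZ : a ∉ Z) (hbZ : b ∉ Z)
    (hZ : ∀ x ∈ Z, ∀ y, G.Adj x y → y ∈ Z ∨ y = a ∨ y = b) (v : V) {u : V}
    (hu : u ∈ Z) (huv : u ≠ v) :
    ∃ y s, y ∈ Z ∧ y ≠ v ∧ (s = a ∨ s = b) ∧ s ≠ v ∧ G.Adj y s ∧ ConnIn G (Z \ {v}) u y := by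
  obtain ⟨t, ht, htv⟩ : ∃ t, t ∉ Z ∧ t ≠ v := by
    by_cases hv : a = v
    · exact ⟨b, hbZ, hv ▸ hab.symm⟩
    · exact ⟨a, haZ, hv⟩
  obtain ⟨p, hp⟩ := (connected_induce_iff_connIn.mp (h2c.2 v)).2 u huv t htv
  clear htv
  induction p with
  | nil => exact absurd hu ht
  | @cons u w t huw p ih =>
    have hwv : w ≠ v := hp w (by simp)
    rcases hZ u hu w huw with hw | hw
    · obtain ⟨y, s, hy, hyv, hs, hsv, hys, hc⟩ :=
        ih hw hwv ht fun x hx => hp x (by simp [hx])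
      exact ⟨y, s, hy, hyv, hs, hsv, hys,
        (ConnIn.of_adj (S := Z \ {v}) huw ⟨hu, huv⟩ ⟨hw, hwv⟩).trans hc⟩
    · exact ⟨u, w, hu, huv, hw, hwv, huw, .refl ⟨hu, huv⟩⟩

namespace IsProper2CutsetSplit

variable {V : Type} {G : SimpleGraph V} {X Y : Set V} {a b : V}

lemma swap (h : IsProper2CutsetSplit G X Y a b) : IsProper2CutsetSplit G X Y b a := by
  have hp : ∀ S : Set V, ContainsPathBetween G (S ∪ {a, b}) a b →
      ContainsPathBetween G (S ∪ {b, a}) b a := by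
    rintro S ⟨p, hp, hpS⟩
    exact ⟨p.reverse, hp.reverse, by simpa [Set.pair_comm b a] using hpS⟩
  have hi : ∀ S : Set V, InducedIsPathGraph G (S ∪ {b, a}) b a →
      InducedIsPathGraph G (S ∪ {a, b}) a b := by
    rintro S ⟨p, hp, hpS, he⟩
    rw [Set.pair_comm b a] at hpS he
    exact ⟨p.reverse, hp.reverse, by simpa using hpS, by simpa using he⟩
  exact ⟨h.hne.symm, fun h' => h.hnadj h'.symm, fun v => by have := h.hcover v; tauto, h.hdisj,
    h.hbX, h.hbY, h.haX, h.haY, h.hX2, h.hY2, h.hsep, hp X h.hXpath,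
    fun h' => h.hXnotpath (hi X h'), hp Y h.hYpath, fun h' => h.hYnotpath (hi Y h')⟩

lemma mem_of_adj (h : IsProper2CutsetSplit G X Y a b) {x y : V} (hx : x ∈ X) (hxy : G.Adj x y) :
    y ∈ X ∨ y = a ∨ y = b := by
  have := h.hcover y
  have := fun hy => h.hsep x hx y hy hxy
  tauto

/-- No path between `a` and `b` on the `X` side has a unique chord: closing it up by an induced
path through `Y` would give a cycle with a unique chord. -/
lemma not_existsUnique_isChord (h : IsProper2CutsetSplit G X Y a b) (huf : UnichordFree G)
    (q : G.Walk b a) (hq : q.IsPath) (hqX : ∀ x ∈ q.support, x ∈ X ∪ {a, b}) :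
    ¬ ∃! e, q.IsChord e := by
  obtain ⟨p, hp, hpc, hpY⟩ : ∃ p : G.Walk a b, p.IsPath ∧ p.IsChordless ∧
      ∀ x ∈ p.support, x ∈ Y ∪ {a, b} := by
    obtain ⟨p, -, hp⟩ := h.hYpath
    exact ConnIn.exists_isPath_isChordless ⟨p, hp⟩
  have hboth : ∀ x, x ∈ p.support → x ∈ q.support → x = a ∨ x = b := by
    intro x hx hx'
    rcases hpY x hx with hxY | hx''
    · rcases hqX x hx' with hxX | hx''
      · exact absurd hxY (h.hdisj.notMem_of_mem_left hxX)
      · exact hx''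
    · exact hx''
  have hcyc : (p.append q).IsCycle := by
    refine hp.isCycle_append hq ?_ (Or.inl ?_)
    · intro x hx hx'
      rcases hboth x (List.mem_of_mem_tail hx) (List.mem_of_mem_tail hx') with rfl | rfl
      · have := hp.support_nodup
        rw [← Walk.cons_tail_support] at this
        exact (List.nodup_cons.mp this).1 hx
      · have := hq.support_nodup
        rw [← Walk.cons_tail_support] at this
        exact (List.nodup_cons.mp this).1 hx'
    · by_contra hlen
      rcases Nat.le_one_iff_eq_zero_or_eq_one.mp (not_lt.mp hlen) with h0 | h1
      · exact h.hne (Walk.eq_of_length_eq_zero h0)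
      · exact h.hnadj (Walk.adj_of_length_eq_one h1)
  have hiff : ∀ e, (p.append q).IsChord e ↔ q.IsChord e := by
    intro e
    induction e with
    | _ x y =>
      rw [Walk.isChord_sym2Mk, Walk.isChord_sym2Mk, Walk.edges_append, List.mem_append,
        Walk.mem_support_append_iff, Walk.mem_support_append_iff]
      constructor
      · rintro ⟨hxy, hne, hx, hy⟩
        rw [not_or] at hne
        have hP : ¬ (x ∈ p.support ∧ y ∈ p.support) := fun h' =>
          hne.1 (hpc.mem_edges h'.1 h'.2 hxy)
        have ha := q.end_mem_support
        have hb := q.start_mem_support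
        have hYp : ∀ z, z ∈ p.support → z ∉ q.support → z ∈ Y := by
          intro z hz hz'
          rcases hpY z hz with hz'' | rfl | rfl
          · exact hz''
          · exact absurd ha hz'
          · exact absurd hb hz'
        have hXq : ∀ z, z ∈ q.support → z ∉ p.support → z ∈ X := by
          intro z hz hz'
          rcases hqX z hz with hz'' | rfl | rfl
          · exact hz''
          · exact absurd p.start_mem_support hz'
          · exact absurd p.end_mem_support hz'
        have key : ∀ z w, G.Adj z w → ¬ (z ∈ p.support ∧ w ∈ p.support) →
            (z ∈ p.support ∨ z ∈ q.support) → (w ∈ p.support ∨ w ∈ q.support) →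
            z ∈ q.support := by
          intro z w hzw hP hz hw
          by_contra hzq
          have hzp := hz.resolve_right hzq
          have hwp : w ∉ p.support := fun hw' => hP ⟨hzp, hw'⟩
          exact h.hsep w (hXq w (hw.resolve_left hwp) hwp) z (hYp z hzp hzq) hzw.symm
        exact ⟨hxy, hne.2, key x y hxy hP hx hy, key y x hxy.symm (fun h' => hP h'.symm) hy hx⟩
      · rintro ⟨hxy, hne, hx, hy⟩
        refine ⟨hxy, ?_, Or.inr hx, Or.inr hy⟩
        rintro (hp' | hq')
        · have := h.hnadj
          have := fun h' : G.Adj b a => h.hnadj h'.symm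
          have := hxy.ne
          rcases hboth x (p.fst_mem_support_of_mem_edges hp') hx with rfl | rfl <;>
          rcases hboth y (p.snd_mem_support_of_mem_edges hp') hy with rfl | rfl <;> contradiction
        · exact hne hq'
  intro hex
  refine huf a _ hcyc ?_
  simpa only [isChord_iff, hiff] using hex

lemma not_existsUnique_isChord_of_ne (h : IsProper2CutsetSplit G X Y a b) (huf : UnichordFree G)
    {s t : V} (hs : s = a ∨ s = b) (ht : t = a ∨ t = b) (hst : s ≠ t) (q : G.Walk t s)
    (hq : q.IsPath) (hqX : ∀ x ∈ q.support, x ∈ X ∪ {a, b}) : ¬ ∃! e, q.IsChord e := by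
  rcases hs with rfl | rfl <;> rcases ht with rfl | rfl
  · exact absurd rfl hst
  · exact h.not_existsUnique_isChord huf q hq hqX
  · exact h.swap.not_existsUnique_isChord huf q hq (by rwa [Set.pair_comm])
  · exact absurd rfl hst

lemma exists_connIn_adj (h : IsProper2CutsetSplit G X Y a b) (h2c : TwoConnected G) (v : V) {u : V}
    (hu : u ∈ X) (huv : u ≠ v) :
    ∃ y s, y ∈ X ∧ y ≠ v ∧ (s = a ∨ s = b) ∧ s ≠ v ∧ G.Adj y s ∧ ConnIn G (X \ {v}) u y :=
  h2c.exists_connIn_adj h.hne h.haX h.hbX (fun _ hx _ hxy => h.mem_of_adj hx hxy) v hu huv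

/-- A common neighbour of `a` and `b` in `X` has no further neighbour in `X`. -/
lemma not_adj_of_common_neighbour (h : IsProper2CutsetSplit G X Y a b) (h2c : TwoConnected G)
    (hsq : ¬ HasSquare G) (huf : UnichordFree G) {w z : V} (hw : w ∈ X) (haw : G.Adj a w)
    (hbw : G.Adj b w) (hz : z ∈ X) : ¬ G.Adj w z := by
  classical
  intro hwz
  have hex : ∃ n, ∃ x y s, ∃ p : G.Walk x y, G.Adj w x ∧ (s = a ∨ s = b) ∧ G.Adj s y ∧
      (∀ t ∈ p.support, t ∈ X \ {w}) ∧ p.length = n := by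
    obtain ⟨y, s, -, -, hs, -, hys, p, hp⟩ := h.exists_connIn_adj h2c w hz hwz.ne'
    exact ⟨_, z, y, s, p, hwz, hs, hys.symm, hp, rfl⟩
  obtain ⟨x, y, s, p, hwx, hs, hsy, hp, hlen⟩ := Nat.find_spec hex
  have hmin : ∀ x' y' s' (q : G.Walk x' y'), G.Adj w x' → (s' = a ∨ s' = b) → G.Adj s' y' →
      (∀ t ∈ q.support, t ∈ X \ {w}) → p.length ≤ q.length :=
    fun x' y' s' q h1 h2 h3 h4 => hlen ▸ Nat.find_min' hex ⟨x', y', s', q, h1, h2, h3, h4, rfl⟩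
  clear hlen hex
  wlog hsa : s = a generalizing a b s
  · exact this h.swap hbw haw s hs.symm hsy
      (fun x' y' s' q h1 h2 h3 h4 => hmin x' y' s' q h1 h2.symm h3 h4) (hs.resolve_left hsa)
  subst hsa
  have hpath := isPath_of_forall_length_le p hp fun q hq => hmin x y s q hwx hs hsy hq
  have hchord := isChordless_of_forall_length_le p hp fun q hq => hmin x y s q hwx hs hsy hq
  have hfirst : ∀ t ∈ p.support, G.Adj w t → t = x := by
    intro t ht hwt
    by_contra htx
    have := hmin t y s (p.dropUntil t ht) hwt hs hsy
      fun r hr => hp r (p.support_dropUntil_subset_support ht hr)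
    have := Walk.length_dropUntil_lt_length ht htx
    omega
  have hlast : ∀ s', (s' = s ∨ s' = b) → ∀ t ∈ p.support, G.Adj s' t → t = y := by
    intro s' hs' t ht hst
    by_contra hty
    have := hmin x t s' (p.takeUntil t ht) hwx hs' hst
      fun r hr => hp r (p.support_takeUntil_subset_support ht hr)
    have := Walk.length_takeUntil_lt_length ht hty
    omega
  have hyw : y ≠ w := (hp y p.end_mem_support).2
  have hb : ∀ t ∈ p.support, ¬ G.Adj b t := by
    intro t ht hbt
    obtain rfl := hlast b (Or.inr rfl) t ht hbt
    exact hyw (eq_of_common_neighbours hsq huf h.hne h.hnadj hsy hbt haw hbw)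
  have hsp : s ∉ p.support := fun h' => h.haX (hp s h').1
  have hbp : b ∉ p.support := fun h' => h.hbX (hp b h').1
  have hwp : w ∉ p.support := fun h' => (hp w h').2 rfl
  have hws := haw.ne
  have hwb := hbw.ne
  have hsb := h.hne
  refine h.not_existsUnique_isChord huf (.cons hbw (.cons hwx (p.concat hsy.symm))) ?_ ?_
    ⟨s(w, s), ?_, ?_⟩
  · rw [Walk.cons_isPath_iff, Walk.cons_isPath_iff, Walk.concat_isPath_iff]
    refine ⟨⟨⟨hpath, hsp⟩, ?_⟩, ?_⟩
    · simp [Walk.support_concat, hwp, hws.symm]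
    · simp [Walk.support_concat, hbp, hwb, hsb.symm]
  · intro t ht
    simp only [Walk.support_cons, Walk.support_concat, List.mem_cons, List.mem_append,
      List.not_mem_nil, or_false] at ht
    rcases ht with rfl | rfl | ht | rfl
    · simp
    · exact Or.inl hw
    · exact Or.inl (hp t ht).1
    · simp
  · have : s(w, s) ∉ p.edges := fun h' => hsp (p.snd_mem_support_of_mem_edges h')
    have hxs : x ≠ s := fun h' => hsp (h' ▸ p.start_mem_support)
    simp only [Walk.isChord_sym2Mk, haw.symm, Walk.edges_cons, Walk.edges_concat,
      Walk.support_cons, Walk.support_concat, List.concat_eq_append, List.mem_cons,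
      List.mem_append, List.not_mem_nil, or_false, Sym2.eq_iff]
    grind
  · intro e he
    induction e with
    | _ t r =>
      simp only [Walk.isChord_sym2Mk, Walk.edges_cons, Walk.edges_concat,
        Walk.support_cons, Walk.support_concat, List.concat_eq_append, List.mem_cons,
        List.mem_append, List.not_mem_nil, or_false, not_or] at he
      obtain ⟨htr, ⟨hne1, hne2, hne3, hne4⟩, ht, hr⟩ := he
      have key : ∀ t r, G.Adj t r → s(t, r) ≠ s(b, w) → s(t, r) ≠ s(w, x) →
          s(t, r) ∉ p.edges → s(t, r) ≠ s(y, s) →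
          (t = b ∨ t = w ∨ t ∈ p.support ∨ t = s) → (r = w ∨ r ∈ p.support ∨ r = s) →
          s(t, r) = s(w, s) := by
        intro t' r' htr' hne1' hne2' hne3' hne4' ht' hr'
        rcases hr' with rfl | hr' | rfl
        · rcases ht' with rfl | rfl | ht' | rfl
          · exact absurd rfl hne1'
          · exact absurd rfl htr'.ne
          · exact absurd (by rw [hfirst t' ht' htr'.symm, Sym2.eq_swap]) hne2'
          · exact Sym2.eq_swap
        · rcases ht' with rfl | rfl | ht' | rfl
          · exact absurd htr' (hb r' hr')
          · exact absurd (by rw [hfirst r' hr' htr']) hne2'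
          · exact absurd (hchord.mem_edges ht' hr' htr') hne3'
          · exact absurd (by rw [hlast t' (Or.inl rfl) r' hr' htr', Sym2.eq_swap]) hne4'
        · rcases ht' with rfl | rfl | ht' | rfl
          · exact absurd htr'.symm h.hnadj
          · rfl
          · exact absurd (by rw [hlast r' (Or.inl rfl) t' ht' htr'.symm]) hne4'
          · exact absurd rfl htr'.ne
      rcases hr with rfl | hr
      · have ht' : t = w ∨ t ∈ p.support ∨ t = s := ht.resolve_left htr.ne
        rw [Sym2.eq_swap]
        exact key r t htr.symm (by rwa [Sym2.eq_swap]) (by rwa [Sym2.eq_swap])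
          (by rwa [Sym2.eq_swap]) (by rwa [Sym2.eq_swap]) (Or.inl rfl) ht'
      · exact key t r htr hne1 hne2 hne3 hne4 ht hr

/-- If no vertex has neighbourhood `{a, b}`, then `a` and `b` have no common neighbour in `X`. -/
lemma not_common_neighbour (h : IsProper2CutsetSplit G X Y a b) (h2c : TwoConnected G)
    (hsq : ¬ HasSquare G) (huf : UnichordFree G)
    (hdeg : ¬ ∃ c : V, c ≠ a ∧ c ≠ b ∧ G.neighborSet c = {a, b}) (w : V) :
    ¬ (w ∈ X ∧ G.Adj a w ∧ G.Adj b w) := by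
  rintro ⟨hw, haw, hbw⟩
  refine hdeg ⟨w, haw.ne', hbw.ne', Set.ext fun z => ⟨fun hz => ?_, ?_⟩⟩
  · exact (h.mem_of_adj hw hz).resolve_left fun hzX =>
      h.not_adj_of_common_neighbour h2c hsq huf hw haw hbw hzX hz
  · rintro (rfl | rfl)
    exacts [haw.symm, hbw.symm]

/-- Removing a vertex `c` with neighbourhood `{a, b}`, or any vertex of `Y`, leaves the `X` side
connected. -/
lemma connIn_diff (h : IsProper2CutsetSplit G X Y a b) (h2c : TwoConnected G) {c : V}
    (hc : c ∈ Y ∨ c ∈ X ∧ G.neighborSet c = {a, b}) :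
    ∀ x ∈ (X ∪ {a, b}) \ {c}, ∀ y ∈ (X ∪ {a, b}) \ {c}, ConnIn G ((X ∪ {a, b}) \ {c}) x y := by
  have hac : a ≠ c := by
    rintro rfl
    exact hc.elim h.haY fun h' => h.haX h'.1
  have hbc : b ≠ c := by
    rintro rfl
    exact hc.elim h.hbY fun h' => h.hbX h'.1
  have ha : a ∈ (X ∪ {a, b}) \ {c} := by simp [hac]
  have hb : b ∈ (X ∪ {a, b}) \ {c} := by simp [hbc]
  have hab : ConnIn G ((X ∪ {a, b}) \ {c}) a b := by
    rcases hc with hcY | ⟨hcX, hN⟩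
    · obtain ⟨p, -, hp⟩ := h.hXpath
      refine ⟨p, fun x hx => ⟨hp x hx, ?_⟩⟩
      rintro rfl
      rcases hp _ hx with hxX | rfl | rfl
      exacts [h.hdisj.notMem_of_mem_left hxX hcY, h.haY hcY, h.hbY hcY]
    · obtain ⟨x, hx, hxc⟩ := Set.exists_ne_of_one_lt_ncard h.hX2 c
      have hZ : ∀ y ∈ X \ {c}, ∀ z, G.Adj y z → z ∈ X \ {c} ∨ z = a ∨ z = b := by
        rintro y ⟨hy, hyc⟩ z hyz
        refine (h.mem_of_adj hy hyz).imp_left fun hz => ⟨hz, ?_⟩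
        rintro rfl
        have : y ∈ G.neighborSet z := hyz.symm
        rw [hN] at this
        rcases this with rfl | rfl
        exacts [h.haX hy, h.hbX hy]
      have hreach : ∀ v s', (∀ s, (s = a ∨ s = b) → s ≠ v → s = s') → v ∉ X →
          s' ∈ (X ∪ {a, b}) \ {c} → ConnIn G ((X ∪ {a, b}) \ {c}) x s' := by
        intro v s' hs' hv hsS
        obtain ⟨y, s, hy, -, hs, hsv, hys, hxy⟩ := h2c.exists_connIn_adj h.hne
          (fun h' => h.haX h'.1) (fun h' => h.hbX h'.1) hZ v ⟨hx, hxc⟩ (fun h' => hv (h' ▸ hx))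
        obtain rfl := hs' s hs hsv
        have hxy' : ConnIn G ((X ∪ {a, b}) \ {c}) x y :=
          hxy.mono fun r hr => ⟨Or.inl hr.1.1, hr.1.2⟩
        exact hxy'.trans (.of_adj hys ⟨Or.inl hy.1, hy.2⟩ hsS)
      exact (hreach b a (fun s hs hsb => hs.resolve_right hsb) h.hbX ha).symm.trans
        (hreach a b (fun s hs hsa => hs.resolve_left hsa) h.haX hb)
  have hxa : ∀ x ∈ (X ∪ {a, b}) \ {c}, ConnIn G ((X ∪ {a, b}) \ {c}) x a := by
    rintro x ⟨hx | rfl | rfl, hxc⟩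
    · obtain ⟨y, s, hy, hyc, hs, hsc, hys, hxy⟩ := h.exists_connIn_adj h2c c hx hxc
      refine (hxy.mono (Set.sdiff_subset_sdiff_left Set.subset_union_left)).trans ?_
      rcases hs with rfl | rfl
      · exact .of_adj hys ⟨Or.inl hy, hyc⟩ ha
      · exact (ConnIn.of_adj hys (S := (X ∪ {a, s}) \ {c}) ⟨Or.inl hy, hyc⟩ hb).trans hab.symm
    · exact .refl ha
    · exact hab.symm
  exact fun x hx y hy => (hxa x hx).trans (hxa y hy).symm

/-- A graph made of the `X` side of the split and a vertex `c'` adjacent to `a` and `b` is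
2-connected. -/
lemma twoConnected_of_map (h : IsProper2CutsetSplit G X Y a b) (h2c : TwoConnected G) {c : V}
    (hc : c ∈ Y ∨ c ∈ X ∧ G.neighborSet c = {a, b}) {W : Type} [Finite W] {H : SimpleGraph W}
    {f : V → W} (hf : Set.InjOn f (X ∪ {a, b}))
    (hadj : ∀ x ∈ X ∪ {a, b}, ∀ y ∈ X ∪ {a, b}, G.Adj x y → H.Adj (f x) (f y)) {c' : W}
    (hc' : ∀ x ∈ X ∪ {a, b}, f x = c' ↔ x = c) (hsurj : ∀ w, w = c' ∨ ∃ x ∈ X ∪ {a, b}, f x = w)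
    (hca : H.Adj c' (f a)) (hcb : H.Adj c' (f b)) : TwoConnected H := by
  have ha : a ∈ X ∪ {a, b} := by simp
  have hb : b ∈ X ∪ {a, b} := by simp
  refine ⟨?_, fun v => connected_induce_iff_connIn.mpr ?_⟩
  · have : ({c', f a, f b} : Set W).ncard = 3 :=
      Set.ncard_eq_three.mpr ⟨_, _, _, hca.ne, hcb.ne, fun h' => h.hne (hf ha hb h'), rfl⟩
    exact this ▸ Set.ncard_le_ncard (Set.subset_univ _)
  by_cases hv : v = c'
  · subst hv
    refine ⟨⟨f a, hca.ne'⟩, fun x hx y hy => ?_⟩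
    obtain ⟨x, hxS, rfl⟩ := (hsurj x).resolve_left hx
    obtain ⟨y, hyS, rfl⟩ := (hsurj y).resolve_left hy
    have hxy := h.connIn_diff h2c hc x ⟨hxS, fun h' => hx ((hc' x hxS).mpr h')⟩ y
      ⟨hyS, fun h' => hy ((hc' y hyS).mpr h')⟩
    have hmem : ∀ x ∈ (X ∪ {a, b}) \ {c}, f x ∈ ({v}ᶜ : Set W) :=
      fun x hx h' => hx.2 ((hc' x hx.1).mp h')
    exact hxy.map f (fun x hx y hy => hadj x hx.1 y hy.1) hmem
  · have hcv : c' ∈ ({v}ᶜ : Set W) := Ne.symm hv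
    obtain ⟨v, hvS, rfl⟩ := (hsurj v).resolve_left hv
    have hne : ∀ x ∈ X ∪ {a, b}, x ≠ v → f x ∈ ({f v}ᶜ : Set W) :=
      fun x hx hxv h' => hxv (hf hx hvS h')
    have hs : ∀ s, (s = a ∨ s = b) → s ≠ v → ConnIn H {f v}ᶜ (f s) c' := by
      rintro s (rfl | rfl) hsv
      · exact .of_adj hca.symm (hne _ ha hsv) hcv
      · exact .of_adj hcb.symm (hne _ hb hsv) hcv
    have hreach : ∀ w ∈ ({f v}ᶜ : Set W), ConnIn H {f v}ᶜ w c' := by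
      intro w hw
      rcases hsurj w with rfl | ⟨x, hx, rfl⟩
      · exact .refl hw
      have hxv : x ≠ v := fun h' => hw (h' ▸ rfl)
      rcases hx with hx | hx
      · obtain ⟨y, s, hy, hyv, hs', hsv, hys, hxy⟩ := h.exists_connIn_adj h2c v hx hxv
        have hsS : s ∈ X ∪ {a, b} := Or.inr hs'
        exact ((hxy.map f (fun x hx y hy => hadj x (Or.inl hx.1) y (Or.inl hy.1))
          fun x hx => hne x (Or.inl hx.1) hx.2).trans (.of_adj (hadj y (Or.inl hy) s hsS hys)
          (hne y (Or.inl hy) hyv) (hne s hsS hsv))).trans (hs s hs' hsv)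
      · exact hs x hx hxv
    exact ⟨⟨c', hcv⟩, fun x hx y hy => (hreach x hx).trans (hreach y hy).symm⟩

end IsProper2CutsetSplit

section BlockWithMarker

variable {V : Type} {G : SimpleGraph V} {X Y : Set V} {a b : V}

@[simp]
lemma blockWithMarker_adj_inl_inl {u v : ↥(X ∪ {a, b})} :
    (BlockWithMarker G X a b).Adj (.inl u) (.inl v) ↔ G.Adj u v := by
  simp only [BlockWithMarker, fromRel_adj]
  refine ⟨fun h => h.2.elim id Adj.symm, fun h => ⟨fun h' => ?_, Or.inl h⟩⟩
  exact h.ne (congrArg Subtype.val (Sum.inl_injective h'))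

@[simp]
lemma blockWithMarker_adj_inl_inr {u : ↥(X ∪ {a, b})} {m : Unit} :
    (BlockWithMarker G X a b).Adj (.inl u) (.inr m) ↔ (u : V) = a ∨ (u : V) = b := by
  simp [BlockWithMarker]

@[simp]
lemma blockWithMarker_adj_inr_inl {u : ↥(X ∪ {a, b})} {m : Unit} :
    (BlockWithMarker G X a b).Adj (.inr m) (.inl u) ↔ (u : V) = a ∨ (u : V) = b := by
  rw [adj_comm, blockWithMarker_adj_inl_inr]

lemma blockWithMarker_neighbour {x : ↥(X ∪ {a, b}) ⊕ Unit} {m : Unit}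
    (h : (BlockWithMarker G X a b).Adj (.inr m) x) :
    ∃ u : ↥(X ∪ {a, b}), x = .inl u ∧ ((u : V) = a ∨ (u : V) = b) := by
  rcases x with u | n
  · exact ⟨u, rfl, blockWithMarker_adj_inr_inl.mp h⟩
  · exact absurd h ((BlockWithMarker G X a b).loopless.irrefl _)

lemma not_hasSquare_blockWithMarker (hsq : ¬ HasSquare G)
    (hcom : ∀ w, ¬ (w ∈ X ∧ G.Adj a w ∧ G.Adj b w)) : ¬ HasSquare (BlockWithMarker G X a b) := by
  have hmarker : ∀ (m : Unit) q r t, (BlockWithMarker G X a b).Adj (.inr m) q →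
      (BlockWithMarker G X a b).Adj q r → (BlockWithMarker G X a b).Adj r t →
      (BlockWithMarker G X a b).Adj t (.inr m) → .inr m ≠ r → q ≠ t → False := by
    intro m q r t hq hqr hrt ht hr hqt
    obtain ⟨q, rfl, hq'⟩ := blockWithMarker_neighbour hq
    obtain ⟨t, rfl, ht'⟩ := blockWithMarker_neighbour ht.symm
    rcases r with r | _
    swap
    · exact hr rfl
    rw [blockWithMarker_adj_inl_inl] at hqr hrt
    have hqt' : (q : V) ≠ t := fun h' => hqt (congrArg _ (Subtype.ext h'))
    have hrab : G.Adj a r ∧ G.Adj b r := by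
      rcases hq' with hq' | hq' <;> rcases ht' with ht' | ht' <;> rw [hq'] at hqr hqt' <;>
        rw [ht'] at hrt hqt'
      exacts [absurd rfl hqt', ⟨hqr, hrt.symm⟩, ⟨hrt.symm, hqr⟩, absurd rfl hqt']
    rcases r.2 with hr | hr | hr
    · exact hcom r ⟨hr, hrab⟩
    · exact hrab.1.ne hr.symm
    · exact hrab.2.ne hr.symm
  rintro ⟨p, q, r, t, hpq, hqr, hrt, htp, hpr, hqt, hpr', hqt'⟩
  rcases p with p | p
  swap
  · exact hmarker p q r t hpq hqr hrt htp hpr' hqt'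
  rcases q with q | q
  swap
  · exact hmarker q r t _ hqr hrt htp hpq hqt' hpr'.symm
  rcases r with r | r
  swap
  · exact hmarker r t _ _ hrt htp hpq hqr hpr'.symm hqt'.symm
  rcases t with t | t
  swap
  · exact hmarker t _ _ _ htp hpq hqr hrt hqt'.symm hpr'
  rw [blockWithMarker_adj_inl_inl] at hpq hqr hrt htp hpr hqt
  exact hsq ⟨p, q, r, t, hpq, hqr, hrt, htp, hpr, hqt, fun h' => hpr' (congrArg _ (Subtype.ext h')),
    fun h' => hqt' (congrArg _ (Subtype.ext h'))⟩

namespace IsProper2CutsetSplit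

lemma twoConnected_blockWithMarker [Finite V] (h : IsProper2CutsetSplit G X Y a b)
    (h2c : TwoConnected G) : TwoConnected (BlockWithMarker G X a b) := by
  classical
  obtain ⟨y, hy⟩ : Y.Nonempty := Set.nonempty_of_ncard_ne_zero (by have := h.hY2; omega)
  have hyS : y ∉ X ∪ {a, b} := by
    rintro (hyX | rfl | rfl)
    exacts [h.hdisj.notMem_of_mem_left hyX hy, h.haY hy, h.hbY hy]
  let f : V → ↥(X ∪ {a, b}) ⊕ Unit := fun x => if hx : x ∈ X ∪ {a, b} then .inl ⟨x, hx⟩ else .inr ()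
  have hf : ∀ x (hx : x ∈ X ∪ {a, b}), f x = .inl ⟨x, hx⟩ := fun x hx => dif_pos hx
  refine h.twoConnected_of_map h2c (Or.inl hy) (f := f) (c' := .inr ()) ?_ ?_ ?_ ?_ ?_ ?_
  · intro x hx z hz hxz
    rw [hf x hx, hf z hz] at hxz
    exact congrArg Subtype.val (Sum.inl_injective hxz)
  · intro x hx z hz hxz
    rw [hf x hx, hf z hz]
    exact blockWithMarker_adj_inl_inl.mpr hxz
  · intro x hx
    rw [hf x hx]
    exact iff_of_false Sum.inl_ne_inr fun h' => hyS (h' ▸ hx)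
  · rintro (u | _)
    · exact Or.inr ⟨u, u.2, hf u u.2⟩
    · exact Or.inl rfl
  · rw [hf a (by simp)]
    exact blockWithMarker_adj_inr_inl.mpr (Or.inl rfl)
  · rw [hf b (by simp)]
    exact blockWithMarker_adj_inr_inl.mpr (Or.inr rfl)

lemma unichordFree_blockWithMarker (h : IsProper2CutsetSplit G X Y a b) (huf : UnichordFree G) :
    UnichordFree (BlockWithMarker G X a b) := by
  classical
  set H := BlockWithMarker G X a b
  let g : ↥(X ∪ {a, b}) ⊕ Unit → V := Sum.elim Subtype.val fun _ => a
  let T : Set (↥(X ∪ {a, b}) ⊕ Unit) := {.inr ()}ᶜ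
  have hT : ∀ x ∈ T, ∃ u, x = .inl u := by
    rintro (u | _) hx
    exacts [⟨u, rfl⟩, absurd rfl hx]
  have hadj : ∀ x ∈ T, ∀ y ∈ T, G.Adj (g x) (g y) ↔ H.Adj x y := by
    intro x hx y hy
    obtain ⟨u, rfl⟩ := hT x hx
    obtain ⟨v, rfl⟩ := hT y hy
    exact blockWithMarker_adj_inl_inl.symm
  have hg : Set.InjOn g T := by
    intro x hx y hy hxy
    obtain ⟨u, rfl⟩ := hT x hx
    obtain ⟨v, rfl⟩ := hT y hy
    exact congrArg _ (Subtype.ext hxy)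
  intro v c hc hex
  simp only [isChord_iff] at hex
  by_cases hm : .inr () ∈ c.support
  swap
  · exact huf.not_existsUnique_isChord hadj hg hc (fun x hx h' => hm (h' ▸ hx)) hex
  have hrot : ∀ e, (c.rotate _ hm).IsChord e ↔ c.IsChord e := by
    intro e
    induction e with
    | _ x y => simp [Walk.isChord_sym2Mk, (c.rotate_edges _ hm).mem_iff]
  simp only [← hrot] at hex
  replace hc := hc.rotate hm
  generalize c.rotate _ hm = d at hc hex
  cases d with
  | nil => exact Walk.not_isCycle_nil hc
  | @cons _ s _ hs p =>
    obtain ⟨hp, hsp⟩ := (Walk.cons_isCycle_iff p hs).mp hc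
    obtain ⟨r, rfl⟩ : ∃ r, p = Walk.reverse r := ⟨p.reverse, by simp⟩
    cases r with
    | nil => exact hs.ne rfl
    | @cons _ t _ ht q =>
      rw [Walk.isPath_reverse_iff, Walk.cons_isPath_iff] at hp
      rw [Walk.edges_reverse, List.mem_reverse, Walk.edges_cons, List.mem_cons, not_or] at hsp
      have hqT : ∀ x ∈ q.support, x ∈ T := fun x hx h' => hp.2 (h' ▸ hx)
      have hchord : ∀ e, (Walk.cons hs (Walk.cons ht q).reverse).IsChord e ↔ q.IsChord e := by
        have hmem : ∀ x, H.Adj (.inr ()) x → x = s ∨ x = t := by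
          intro x hx
          obtain ⟨x, rfl, hx'⟩ := blockWithMarker_neighbour hx
          obtain ⟨s, rfl, hs'⟩ := blockWithMarker_neighbour hs
          obtain ⟨t, rfl, ht'⟩ := blockWithMarker_neighbour ht
          have hst : (s : V) ≠ t := fun h' => hsp.1 (by rw [Subtype.ext h'])
          rcases hx' with hx' | hx' <;> rcases hs' with hs' | hs' <;> rcases ht' with ht' | ht' <;>
            grind
        intro e
        induction e with
        | _ x y =>
          have := q.start_mem_support
          have := q.end_mem_support
          simp only [Walk.isChord_sym2Mk, Walk.edges_cons, Walk.edges_reverse, List.mem_cons,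
            List.mem_reverse, Walk.support_cons, Walk.support_reverse, Sym2.eq_iff]
          have := hmem x
          have := hmem y
          have hx := fun hx : x ∈ q.support => hqT x hx
          have hy := fun hy : y ∈ q.support => hqT y hy
          have hxy : H.Adj x y → x ≠ y ∧ H.Adj y x := fun h' => ⟨h'.ne, h'.symm⟩
          simp only [T, Set.mem_compl_iff, Set.mem_singleton_iff] at hx hy
          grind
      simp only [hchord] at hex
      obtain ⟨q', hs', he'⟩ :=
        exists_walk_map g (fun x hx y hy h' => (hadj x hx y hy).mpr h') q hqT
      have hex' := existsUnique_isChord_of_map hadj hg hqT hs' he' hex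
      have hq' : q'.IsPath := by
        rw [Walk.isPath_def, hs']
        exact ((Walk.isPath_def q).mp hp.1).map_on
          fun x hx y hy => @hg x (hqT x hx) y (hqT y hy)
      have hqX : ∀ x ∈ q'.support, x ∈ X ∪ {a, b} := by
        intro x hx
        rw [hs', List.mem_map] at hx
        obtain ⟨y, hy, rfl⟩ := hx
        obtain ⟨u, rfl⟩ := hT y (hqT y hy)
        exact u.2
      obtain ⟨s, rfl, hsab⟩ := blockWithMarker_neighbour hs
      obtain ⟨t, rfl, htab⟩ := blockWithMarker_neighbour ht
      exact h.not_existsUnique_isChord_of_ne huf hsab htab (fun h' => hsp.1 (by rw [Subtype.ext h']))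
        q' hq' hqX hex'

end IsProper2CutsetSplit

end BlockWithMarker

/-- The graph induced by the `X` side together with a vertex of neighbourhood `{a, b}` is
2-connected. -/
lemma IsProper2CutsetSplit.twoConnected_induce {V : Type} [Finite V] {G : SimpleGraph V}
    {X Y : Set V} {a b c : V} (h : IsProper2CutsetSplit G X Y a b) (h2c : TwoConnected G)
    (hca : c ≠ a) (hcb : c ≠ b) (hN : G.neighborSet c = {a, b}) :
    TwoConnected (G.induce (X ∪ {a, b, c})) := by
  classical
  have hc : c ∈ Y ∨ c ∈ X ∧ G.neighborSet c = {a, b} := by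
    have := h.hcover c
    tauto
  have hS : ∀ x ∈ X ∪ {a, b}, x ∈ X ∪ {a, b, c} := by
    rintro x (hx | rfl | rfl) <;> simp [*]
  have hcS : c ∈ X ∪ {a, b, c} := by simp
  let f : V → ↥(X ∪ {a, b, c}) := fun x => if hx : x ∈ X ∪ {a, b} then ⟨x, hS x hx⟩ else ⟨c, hcS⟩
  have hf : ∀ x (hx : x ∈ X ∪ {a, b}), (f x : V) = x :=
    fun x hx => congrArg Subtype.val (dif_pos hx : f x = ⟨x, hS x hx⟩)
  have hadj : ∀ s, G.Adj c s ↔ s = a ∨ s = b := fun s => by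
    rw [← mem_neighborSet, hN]
    rfl
  refine h.twoConnected_of_map h2c hc (f := f) (c' := ⟨c, hcS⟩) ?_ ?_ ?_ ?_ ?_ ?_
  · intro x hx z hz hxz
    rw [← hf x hx, ← hf z hz, hxz]
  · intro x hx z hz hxz
    rw [induce_adj, hf x hx, hf z hz]
    exact hxz
  · intro x hx
    rw [Subtype.ext_iff, hf x hx]
  · rintro ⟨x, hx | hx | hx | hx⟩
    · exact Or.inr ⟨x, Or.inl hx, Subtype.ext (hf x (Or.inl hx))⟩
    · exact Or.inr ⟨x, Or.inr (Or.inl hx), Subtype.ext (hf x (Or.inr (Or.inl hx)))⟩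
    · exact Or.inr ⟨x, Or.inr (Or.inr hx), Subtype.ext (hf x (Or.inr (Or.inr hx)))⟩
    · exact Or.inl (Subtype.ext hx)
  · rw [induce_adj, hf a (by simp), hadj]
    exact Or.inl rfl
  · rw [induce_adj, hf b (by simp), hadj]
    exact Or.inr rfl

/-- The block of decomposition `G_X` of a 2-connected {square,unichord}-free
graph with respect to a proper 2-cutset is 2-connected, square-free and
unichord-free.  If some vertex `c` of `G` has neighbourhood exactly `{a, b}`,
the block is `G[X ∪ {a,b,c}]`; otherwise a new marker vertex is added. -/
theorem stmt12 {V : Type} [Fintype V] (G : SimpleGraph V) (h2c : TwoConnected G)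
    (hsq : ¬ HasSquare G) (huf : UnichordFree G) (X Y : Set V) (a b : V)
    (hsplit : IsProper2CutsetSplit G X Y a b) :
    (∀ c : V, c ≠ a → c ≠ b → G.neighborSet c = {a, b} →
      TwoConnected (G.induce (X ∪ {a, b, c})) ∧
        ¬ HasSquare (G.induce (X ∪ {a, b, c})) ∧
        UnichordFree (G.induce (X ∪ {a, b, c}))) ∧
    ((¬ ∃ c : V, c ≠ a ∧ c ≠ b ∧ G.neighborSet c = {a, b}) →
      TwoConnected (BlockWithMarker G X a b) ∧
        ¬ HasSquare (BlockWithMarker G X a b) ∧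
        UnichordFree (BlockWithMarker G X a b)) := by
  refine ⟨fun c hca hcb hN => ⟨hsplit.twoConnected_induce h2c hca hcb hN,
    fun h => hsq (h.of_embedding (Embedding.induce _)), huf.of_embedding (Embedding.induce _)⟩,
    fun hdeg => ⟨hsplit.twoConnected_blockWithMarker h2c, not_hasSquare_blockWithMarker hsq
      (hsplit.not_common_neighbour h2c hsq huf hdeg), hsplit.unichordFree_blockWithMarker huf⟩⟩
end

section
/- Every 2-connected sparse graph G of maximum degree 3 admits a total-colouring with 4 colours. Moreover, if u is a degree-2 vertex with neighbours a, b both of degree 3, then any precolouring assigning colour 1 to a and b, colour 2 to au, and colour 3 to ub extends to a 4-total-colouring of G. -/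
open SimpleGraph

section Konig

variable {V : Type} [Fintype V] [DecidableEq V]

/-- A matrix of natural numbers with constant positive row and column sums has a permutation
in its support. -/
lemma exists_perm_pos_of_sum_eq {k : ℕ} (hk : 0 < k) (M : V → V → ℕ)
    (hrow : ∀ i, ∑ j, M i j = k) (hcol : ∀ j, ∑ i, M i j = k) :
    ∃ σ : Equiv.Perm V, ∀ i, 0 < M i (σ i) := by
  let f (i : V) : Finset V := Finset.univ.filter fun j => M i j ≠ 0
  have hf (A : Finset V) : A.card ≤ (A.biUnion f).card := by
    have h₁ : ∑ i ∈ A, ∑ j ∈ f i, M i j = A.card * k := by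
      have (i : V) : ∑ j ∈ f i, M i j = k := by
        rw [← hrow i]
        exact Finset.sum_filter_ne_zero _
      simp [this]
    have h₂ : ∑ i, ∑ j ∈ A.biUnion f, M i j = (A.biUnion f).card * k := by
      rw [Finset.sum_comm]
      simp [hcol]
    refine Nat.le_of_mul_le_mul_right ?_ hk
    rw [← h₁, ← h₂]
    calc ∑ i ∈ A, ∑ j ∈ f i, M i j ≤ ∑ i ∈ A, ∑ j ∈ A.biUnion f, M i j :=
          Finset.sum_le_sum fun i hi =>
            Finset.sum_le_sum_of_subset (Finset.subset_biUnion_of_mem f hi)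
      _ ≤ _ := Finset.sum_le_sum_of_subset (Finset.subset_univ _)
  obtain ⟨g, hg, hg'⟩ := (Finset.all_card_le_biUnion_card_iff_exists_injective f).1 hf
  refine ⟨Equiv.ofBijective g (Finite.injective_iff_bijective.1 hg), fun i => ?_⟩
  have := hg' i
  simp only [f, Finset.mem_filter] at this
  exact Nat.pos_of_ne_zero this.2

/-- A matrix of natural numbers with all row and column sums equal to `k` is covered by `k`
permutations. -/
lemma exists_perms_cover_of_sum_eq (k : ℕ) (M : V → V → ℕ)
    (hrow : ∀ i, ∑ j, M i j = k) (hcol : ∀ j, ∑ i, M i j = k) :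
    ∃ σ : Fin k → Equiv.Perm V, ∀ i j, 0 < M i j → ∃ t, σ t i = j := by
  induction k generalizing M with
  | zero =>
    refine ⟨fun _ => 1, fun i j h => ?_⟩
    have := Finset.sum_eq_zero_iff.1 (hrow i) j (Finset.mem_univ j)
    omega
  | succ k ih =>
    obtain ⟨τ, hτ⟩ := exists_perm_pos_of_sum_eq k.succ_pos M hrow hcol
    have hM (i j : V) : M i j = (M i j - if τ i = j then 1 else 0) + if τ i = j then 1 else 0 := by
      have := hτ i
      split_ifs with h
      · subst h; omega
      · simp
    obtain ⟨σ, hσ⟩ := ih (fun i j => M i j - if τ i = j then 1 else 0)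
      (fun i => by
        have h := hrow i
        rw [Finset.sum_congr rfl fun j _ => hM i j, Finset.sum_add_distrib] at h
        simpa using h)
      (fun j => by
        have h := hcol j
        rw [Finset.sum_congr rfl fun i _ => hM i j, Finset.sum_add_distrib] at h
        have h' : ∑ i, (if τ i = j then 1 else 0) = 1 := by
          simp [← Equiv.eq_symm_apply]
        rw [h'] at h
        omega)
    refine ⟨Fin.cons τ σ, fun i j hij => ?_⟩
    by_cases h : τ i = j
    · exact ⟨0, by simpa using h⟩
    · obtain ⟨t, ht⟩ := hσ i j (by simpa [h] using hij)
      exact ⟨t.succ, by simpa using ht⟩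

/-- The arcs of a graph of maximum degree at most `k` can be coloured with `k` colours so that
arcs with the same tail, or with the same head, get different colours. -/
lemma exists_arc_colouring (G : SimpleGraph V) (k : ℕ) [NeZero k]
    (hdeg : ∀ v, (G.neighborSet v).ncard ≤ k) :
    ∃ c : V → V → Fin k, (∀ x y z, G.Adj x y → G.Adj x z → c x y = c x z → y = z) ∧
      ∀ x y z, G.Adj y x → G.Adj z x → c y x = c z x → y = z := by
  classical
  let M (x y : V) : ℕ := (if G.Adj x y then 1 else 0) +
    if x = y then k - (G.neighborSet x).ncard else 0
  have hrow (x : V) : ∑ y, M x y = k := by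
    have h : (G.neighborSet x).ncard = ∑ y, if G.Adj x y then 1 else 0 := by
      rw [Finset.sum_boole, ← Set.ncard_coe_finset]
      congr
      ext
      simp
    simp only [M, Finset.sum_add_distrib, ← h, Finset.sum_ite_eq, Finset.mem_univ, if_true]
    have := hdeg x
    omega
  have hcol (y : V) : ∑ x, M x y = k := by
    rw [← hrow y]
    refine Finset.sum_congr rfl fun x _ => ?_
    by_cases h : x = y
    · rw [h]
    · simp [M, h, Ne.symm h, G.adj_comm]
  obtain ⟨σ, hσ⟩ := exists_perms_cover_of_sum_eq k M hrow hcol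
  have (x y : V) : ∃ t, G.Adj x y → σ t x = y := by
    by_cases h : G.Adj x y
    · exact (hσ x y (by simp [M, h])).imp fun _ ht _ => ht
    · exact ⟨0, fun h' => absurd h' h⟩
  choose c hc using this
  refine ⟨c, fun x y z hy hz h => ?_, fun x y z hy hz h => ?_⟩
  · rw [← hc x y hy, h, hc x z hz]
  · refine (σ (c y x)).injective ?_
    rw [hc y x hy, h, hc z x hz]

end Konig

section Extension

variable {V : Type} {G : SimpleGraph V}

/-- A partial total colouring in which the vertices of `C` and the edges meeting `C` are coloured,
and which can be continued greedily when all vertices outside `C` have degree at most two. -/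
structure IsPartialColouring (G : SimpleGraph V) (C : Set V) (f : V → Fin 4)
    (e : V → V → Fin 4) : Prop where
  symm : ∀ x y, e x y = e y x
  vertex_ne : ∀ x ∈ C, ∀ y ∈ C, G.Adj x y → f x ≠ f y
  vertex_ne_edge : ∀ x ∈ C, ∀ y, G.Adj x y → f x ≠ e x y
  edge_ne : ∀ x y z, G.Adj x y → G.Adj x z → y ≠ z → (x ∈ C ∨ y ∈ C ∧ z ∈ C) → e x y ≠ e x z
  available : ∀ v ∉ C, ∃ c, ∀ p ∈ C, G.Adj v p → c ≠ f p ∧ c ≠ e v p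
  lt_of_unique : ∀ v ∉ C, ∀ p ∈ C, G.Adj v p → (∀ q ∈ C, G.Adj v q → q = p) → f p < e v p

set_option synthInstance.maxSize 1000 in
lemma exists_colours_between (p e q g : Fin 4) (hpe : p < e) (hqg : q < g) :
    ∃ v : Fin 4, v ≠ p ∧ v ≠ e ∧ ∃ a : Fin 4, a ≠ v ∧ a ≠ e ∧ a ≠ g ∧
      ∃ n : Fin 4, n ≠ v ∧ n ≠ a ∧ n ≠ q ∧ n ≠ g := by
  decide +revert

lemma exists_increasing_pair (p e : Fin 4) :
    p < e → ∃ v a : Fin 4, v ≠ p ∧ v ≠ e ∧ a ≠ e ∧ v < a := by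
  decide +revert

lemma exists_ne_ne (a b : Fin 4) : ∃ c : Fin 4, c ≠ a ∧ c ≠ b := by
  decide +revert

namespace IsPartialColouring

variable {C : Set V} {f : V → Fin 4} {e : V → V → Fin 4}

lemma insert_of_neighbors_mem (h : IsPartialColouring G C f e) {v : V} (hv : v ∉ C)
    (hn : ∀ n, G.Adj v n → n ∈ C) :
    ∃ f', IsPartialColouring G (insert v C) f' e ∧ ∀ x ∈ C, f' x = f x := by
  classical
  obtain ⟨c, hc⟩ := h.available v hv
  have hadj := G.adj_comm
  have hirr : ∀ x, ¬ G.Adj x x := fun x => G.irrefl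
  obtain ⟨h1, h2, h3, h4, h5, h6⟩ := h
  refine ⟨Function.update f v c, ⟨h1, ?_, ?_, ?_, ?_, ?_⟩, ?_⟩
  · grind [Function.update_apply]
  · grind [Function.update_apply]
  · grind [Function.update_apply]
  · intro w hw
    obtain ⟨d, hd⟩ := h5 w (by grind)
    exact ⟨d, by grind [Function.update_apply]⟩
  · grind [Function.update_apply]
  · grind [Function.update_apply]

/-- Colouring a vertex `v` whose neighbours are `p ∈ C` and `n ∉ C` with `a`, and the edge `vn`
with `b`. -/
lemma insert_of_colours (h : IsPartialColouring G C f e) {v p n : V} (hv : v ∉ C) (hp : p ∈ C)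
    (hn : n ∉ C) (hvp : G.Adj v p) (hvn : G.Adj v n) (hvN : ∀ x, G.Adj v x → x = p ∨ x = n)
    {a b : Fin 4} (hap : a ≠ f p) (hae : a ≠ e v p) (hba : b ≠ a) (hbe : b ≠ e v p)
    (hbn : ∀ q ∈ C, G.Adj n q → b ≠ e n q)
    (hc : ∃ c, c ≠ a ∧ c ≠ b ∧ ∀ q ∈ C, G.Adj n q → c ≠ f q ∧ c ≠ e n q)
    (hlt : a < b ∨ ∃ q ∈ C, G.Adj n q) :
    ∃ f' e', IsPartialColouring G (insert v C) f' e' ∧ (∀ x ∈ C, f' x = f x) ∧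
      ∀ x ∈ C, ∀ y, G.Adj x y → e' x y = e x y := by
  classical
  have hne : ∀ x ∈ C, x ≠ v ∧ x ≠ n := fun x hx => ⟨ne_of_mem_of_not_mem hx hv,
    ne_of_mem_of_not_mem hx hn⟩
  have hnv : n ≠ v := hvn.ne'
  have hpv : p ≠ v := hvp.ne'
  have hpn : p ≠ n := (hne p hp).2
  have hfar : ∀ w ∉ C, w ≠ n → ¬ G.Adj w v := fun w hw hwn hwv => by
    rcases hvN w hwv.symm with rfl | rfl <;> contradiction
  obtain ⟨h1, h2, h3, h4, h5, h6⟩ := h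
  refine ⟨Function.update f v a,
    fun x y => if x = v ∧ y = n ∨ x = n ∧ y = v then b else e x y,
    ⟨?_, ?_, ?_, ?_, ?_, ?_⟩, ?_, ?_⟩
  · grind
  · have key : ∀ y ∈ C, G.Adj v y → a ≠ f y := fun y hy hvy => by
      rcases hvN y hvy with rfl | rfl
      · exact hap
      · contradiction
    rintro x (rfl | hx) y (rfl | hy) hxy
    · exact absurd rfl hxy.ne
    · simpa [hne y hy] using key y hy hxy
    · simpa [hne x hx] using (key x hx hxy.symm).symm
    · simpa [hne x hx, hne y hy] using h2 x hx y hy hxy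
  · rintro x (rfl | hx) y hxy
    · rcases hvN y hxy with rfl | rfl
      · simpa [hpn, hnv.symm] using hae
      · simpa using hba.symm
    · simpa [hne x hx] using h3 x hx y hxy
  · intro x y z hxy hxz hyz hor
    by_cases hx : x = v
    · subst hx
      rcases hvN y hxy with rfl | rfl <;> rcases hvN z hxz with rfl | rfl <;> grind
    by_cases hxn : x = n
    · subst hxn
      obtain ⟨hy, hz⟩ : y ∈ insert v C ∧ z ∈ insert v C :=
        hor.resolve_left (by rintro (hx' | hx') <;> contradiction)
      rcases hy with rfl | hy <;> rcases hz with rfl | hz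
      · contradiction
      · simpa [hnv, hne z hz] using hbn z hz hxz
      · simpa [hnv, hne y hy] using (hbn y hy hxy).symm
      · simpa [hne y hy, hne z hz] using h4 x y z hxy hxz hyz (Or.inr ⟨hy, hz⟩)
    · have hor' : x ∈ C ∨ y ∈ C ∧ z ∈ C := by
        have := hfar x
        grind
      simpa [hx, hxn] using h4 x y z hxy hxz hyz hor'
  · intro w hw
    rw [Set.mem_insert_iff, not_or] at hw
    by_cases hwn : w = n
    · subst hwn
      obtain ⟨c, hca, hcb, hc⟩ := hc
      refine ⟨c, ?_⟩
      rintro r (rfl | hr) hwr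
      · simpa using ⟨hca, hcb⟩
      · simpa [hne r hr] using hc r hr hwr
    · obtain ⟨d, hd⟩ := h5 w hw.2
      refine ⟨d, ?_⟩
      rintro r (rfl | hr) hwr
      · exact absurd hwr (hfar w hw.2 hwn)
      · simpa [hne r hr, hwn] using hd r hr hwr
  · intro w hw r hr hwr hu
    rw [Set.mem_insert_iff, not_or] at hw
    by_cases hwn : w = n
    · subst hwn
      obtain rfl := hu v (Set.mem_insert _ _) hvn.symm
      rcases hlt with hlt | ⟨q, hq, hwq⟩
      · simpa using hlt
      · exact absurd (hu q (Set.mem_insert_of_mem _ hq) hwq) (hne q hq).1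
    · rcases hr with rfl | hr
      · exact absurd hwr (hfar w hw.2 hwn)
      · simpa [hne r hr, hwn] using
          h6 w hw.2 r hr hwr fun q hq => hu q (Set.mem_insert_of_mem _ hq)
  · intro x hx
    simp [hne x hx]
  · intro x hx y _
    simp [hne x hx]

lemma insert_of_adj (h : IsPartialColouring G C f e)
    (hdeg : ∀ v ∉ C, ∀ x y z, G.Adj v x → G.Adj v y → G.Adj v z → x = y ∨ y = z ∨ x = z)
    {v p n : V} (hv : v ∉ C) (hp : p ∈ C) (hn : n ∉ C) (hvp : G.Adj v p) (hvn : G.Adj v n) :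
    ∃ f' e', IsPartialColouring G (insert v C) f' e' ∧ (∀ x ∈ C, f' x = f x) ∧
      ∀ x ∈ C, ∀ y, G.Adj x y → e' x y = e x y := by
  have hvN : ∀ x, G.Adj v x → x = p ∨ x = n := fun x hx => by
    have := hdeg v hv x p n hx hvp hvn
    grind
  have hpe : f p < e v p := h.lt_of_unique v hv p hp hvp fun q hq hvq =>
    (hvN q hvq).resolve_right (ne_of_mem_of_not_mem hq hn)
  by_cases hnC : ∃ q ∈ C, G.Adj n q
  · have hnC' := hnC
    obtain ⟨q, hq, hnq⟩ := hnC'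
    have hnN : ∀ x ∈ C, G.Adj n x → x = q := fun x hx hnx => by
      have := hdeg n hn x q v hnx hnq hvn.symm
      grind
    obtain ⟨a, hap, hae, b, hba, hbe, hbn, c, hca, hcb, hcf, hce⟩ :=
      exists_colours_between _ _ _ _ hpe (h.lt_of_unique n hn q hq hnq hnN)
    refine h.insert_of_colours hv hp hn hvp hvn hvN hap hae hba hbe ?_ ⟨c, hca, hcb, ?_⟩ (.inr hnC)
    · intro x hx hnx
      rwa [hnN x hx hnx]
    · intro x hx hnx
      rw [hnN x hx hnx]
      exact ⟨hcf, hce⟩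
  · push Not at hnC
    obtain ⟨a, b, hap, hae, hbe, hab⟩ := exists_increasing_pair _ _ hpe
    obtain ⟨c, hca, hcb⟩ := exists_ne_ne a b
    exact h.insert_of_colours hv hp hn hvp hvn hvN hap hae hab.ne' hbe
      (fun q hq hnq => absurd hnq (hnC q hq))
      ⟨c, hca, hcb, fun q hq hnq => absurd hnq (hnC q hq)⟩ (.inl hab)

lemma insert_of_closed (h : IsPartialColouring G C f e)
    (hdeg : ∀ v ∉ C, ∀ x y z, G.Adj v x → G.Adj v y → G.Adj v z → x = y ∨ y = z ∨ x = z)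
    (hC : ∀ w ∉ C, ∀ q ∈ C, ¬ G.Adj w q) {v n : V} (hv : v ∉ C) (hvn : G.Adj v n) :
    ∃ f' e', IsPartialColouring G (insert v C) f' e' ∧ (∀ x ∈ C, f' x = f x) ∧
      ∀ x ∈ C, ∀ y, G.Adj x y → e' x y = e x y := by
  classical
  have hadj := G.adj_comm
  have hirr : ∀ x, ¬ G.Adj x x := fun x => G.irrefl
  obtain ⟨h1, h2, h3, h4, h5, h6⟩ := h
  refine ⟨Function.update f v 0,
    fun x y => if x = v ∧ y = n ∨ x = n ∧ y = v then 1 else if x = v ∨ y = v then 2 else e x y,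
    ⟨?_, ?_, ?_, ?_, ?_, ?_⟩, ?_, ?_⟩
  · grind
  · grind [Function.update_apply]
  · grind [Function.update_apply]
  · intro x y z
    by_cases hx : x = v
    · grind
    · by_cases hxn : x = n <;> grind
  · intro w hw
    exact ⟨3, by grind [Function.update_apply]⟩
  · grind [Function.update_apply]
  · grind [Function.update_apply]
  · grind

/-- A partial colouring extends to the whole graph. -/
theorem exists_extension [Finite V] (h : IsPartialColouring G C f e)
    (hdeg : ∀ v ∉ C, ∀ x y z, G.Adj v x → G.Adj v y → G.Adj v z → x = y ∨ y = z ∨ x = z) :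
    ∃ f' e', IsPartialColouring G Set.univ f' e' ∧ (∀ x ∈ C, f' x = f x) ∧
      ∀ x ∈ C, ∀ y, G.Adj x y → e' x y = e x y := by
  induction hN : Cᶜ.ncard using Nat.strong_induction_on generalizing C f e with
  | _ N ih =>
  by_cases hC : C = Set.univ
  · subst hC
    exact ⟨f, e, h, fun _ _ => rfl, fun _ _ _ _ => rfl⟩
  have step : ∃ v ∉ C, ∃ f' e', IsPartialColouring G (insert v C) f' e' ∧ (∀ x ∈ C, f' x = f x) ∧
      ∀ x ∈ C, ∀ y, G.Adj x y → e' x y = e x y := by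
    obtain ⟨v, hv⟩ := (Set.ne_univ_iff_exists_notMem C).1 hC
    by_cases h₁ : ∃ v ∉ C, ∀ n, G.Adj v n → n ∈ C
    · obtain ⟨v, hv, hn⟩ := h₁
      obtain ⟨f', hf', h'⟩ := h.insert_of_neighbors_mem hv hn
      exact ⟨v, hv, f', e, hf', h', fun _ _ _ _ => rfl⟩
    push Not at h₁
    by_cases h₂ : ∃ v ∉ C, ∃ p ∈ C, G.Adj v p
    · obtain ⟨v, hv, p, hp, hvp⟩ := h₂
      obtain ⟨n, hvn, hn⟩ := h₁ v hv
      exact ⟨v, hv, h.insert_of_adj hdeg hv hp hn hvp hvn⟩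
    · push Not at h₂
      obtain ⟨n, hvn, -⟩ := h₁ v hv
      exact ⟨v, hv, h.insert_of_closed hdeg h₂ hv hvn⟩
  obtain ⟨v, hv, f₁, e₁, h', hf, he⟩ := step
  have hlt : (insert v C)ᶜ.ncard < N := by
    rw [← hN]
    refine Set.ncard_lt_ncard ?_ (Set.toFinite _)
    exact compl_lt_compl_iff_lt.2 (Set.ssubset_insert hv)
  obtain ⟨f₂, e₂, h'', hf', he'⟩ :=
    ih _ hlt h' (fun w hw => hdeg w fun hw' => hw (Set.mem_insert_of_mem _ hw')) rfl
  refine ⟨f₂, e₂, h'', fun x hx => ?_, fun x hx y hxy => ?_⟩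
  · rw [hf' x (Set.mem_insert_of_mem _ hx), hf x hx]
  · rw [he' x (Set.mem_insert_of_mem _ hx) y hxy, he x hx y hxy]

lemma isTotalColouring (h : IsPartialColouring G Set.univ f e) :
    IsTotalColouring G f (Sym2.lift ⟨e, h.symm⟩) := by
  refine ⟨fun u v => h.vertex_ne u trivial v trivial, ?_, ?_⟩
  · rintro e₁ e₂ h₁ h₂ hne ⟨x, hx₁, hx₂⟩
    obtain ⟨y, rfl⟩ := hx₁
    obtain ⟨z, rfl⟩ := hx₂
    exact h.edge_ne x y z h₁ h₂ (by rintro rfl; exact hne rfl) (Or.inl trivial)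
  · rintro x e₁ h₁ ⟨y, rfl⟩
    exact h.vertex_ne_edge x trivial y h₁

end IsPartialColouring

end Extension

lemma eq_or_eq_of_ncard_neighborSet_lt_three {V : Type} [Finite V] {G : SimpleGraph V} {v : V}
    (hv : (G.neighborSet v).ncard < 3) (x y z : V) (hx : G.Adj v x) (hy : G.Adj v y)
    (hz : G.Adj v z) : x = y ∨ y = z ∨ x = z := by
  by_contra! h
  obtain ⟨hxy, hyz, hxz⟩ := h
  have hsub : ({x, y, z} : Set V) ⊆ G.neighborSet v := by
    rintro w (rfl | rfl | rfl) <;> assumption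
  have := Set.ncard_le_ncard hsub (Set.toFinite _)
  rw [Set.ncard_eq_three.2 ⟨x, y, z, hxy, hxz, hyz, rfl⟩] at this
  omega

lemma exists_ne_ne_ne (a b c : Fin 4) : ∃ d : Fin 4, d ≠ a ∧ d ≠ b ∧ d ≠ c := by
  decide +revert

lemma exists_perm_apply_eq_zero_one (i j : Fin 3) :
    i ≠ j → ∃ π : Equiv.Perm (Fin 3), π i = 0 ∧ π j = 1 := by
  decide +revert

/-- An arc colouring with three colours induces, on the edges meeting the vertices of degree
three, a colouring that extends to a total colouring giving those vertices a fourth colour. -/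
lemma exists_isTotalColouring_of_arc_colouring {V : Type} [Finite V] {G : SimpleGraph V}
    (hsp : Sparse G) (c : V → V → Fin 3)
    (hout : ∀ x y z, G.Adj x y → G.Adj x z → c x y = c x z → y = z)
    (hin : ∀ x y z, G.Adj y x → G.Adj z x → c y x = c z x → y = z) :
    ∃ (fv : V → Fin 4) (fe : Sym2 V → Fin 4), IsTotalColouring G fv fe ∧
      ∀ x, 3 ≤ (G.neighborSet x).ncard → fv x = 0 ∧
        ∀ y, G.Adj x y → fe s(x, y) = (c x y).succ := by
  classical
  let D : Set V := {x | 3 ≤ (G.neighborSet x).ncard}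
  have hD : ∀ x ∈ D, ∀ y ∈ D, ¬ G.Adj x y := fun x hx y hy hxy => hsp x y hxy ⟨hx, hy⟩
  have hdeg : ∀ v ∉ D, ∀ x y z, G.Adj v x → G.Adj v y → G.Adj v z → x = y ∨ y = z ∨ x = z :=
    fun v hv => eq_or_eq_of_ncard_neighborSet_lt_three (not_le.1 hv)
  let e (x y : V) : Fin 4 := if x ∈ D ∧ y ∉ D then (c x y).succ else
    if y ∈ D ∧ x ∉ D then (c y x).succ else 0
  have he : ∀ x ∈ D, ∀ y, G.Adj x y → e x y = (c x y).succ := fun x hx y hxy =>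
    if_pos ⟨hx, fun hy => hD x hx y hy hxy⟩
  have hsymm : ∀ x y, e x y = e y x := by
    intro x y
    simp only [e]
    by_cases hx : x ∈ D <;> by_cases hy : y ∈ D <;> simp [hx, hy]
  have he' : ∀ x ∈ D, ∀ y, G.Adj y x → e y x = (c x y).succ := fun x hx y hxy => by
    rw [hsymm, he x hx y hxy.symm]
  have hpart : IsPartialColouring G D (fun _ => 0) e := by
    refine ⟨hsymm, fun x hx y hy hxy => absurd hxy (hD x hx y hy), fun x hx y hxy => ?_,
      fun x y z hy hz hyz hor heq => ?_, fun v hv => ?_, fun v hv p hp hvp _ => ?_⟩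
    · rw [he x hx y hxy]
      exact (Fin.succ_ne_zero _).symm
    · rcases hor with hx | ⟨hyD, hzD⟩
      · rw [he x hx y hy, he x hx z hz] at heq
        exact hyz (hout x y z hy hz (Fin.succ_injective _ heq))
      · rw [he' y hyD x hy, he' z hzD x hz] at heq
        exact hyz (hin x y z hy.symm hz.symm (Fin.succ_injective _ heq))
    · obtain ⟨x, y, hxy⟩ : ∃ x y, ∀ z, G.Adj v z → z = x ∨ z = y := by
        by_contra! hne
        obtain ⟨x, hx, -⟩ := hne v v
        obtain ⟨y, hy, hyx, -⟩ := hne x x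
        obtain ⟨z, hz, hzx, hzy⟩ := hne x y
        rcases hdeg v hv x y z hx hy hz with h | h | h
        · exact hyx h.symm
        · exact hzy h.symm
        · exact hzx h.symm
      obtain ⟨d, hd₀, hdx, hdy⟩ := exists_ne_ne_ne 0 (e v x) (e v y)
      refine ⟨d, fun p _ hp => ⟨hd₀, ?_⟩⟩
      rcases hxy p hp with rfl | rfl <;> assumption
    · rw [he' p hp v hvp]
      exact Fin.succ_pos _
  obtain ⟨f', e', h', hf, hee⟩ := hpart.exists_extension hdeg
  refine ⟨f', _, h'.isTotalColouring, fun x hx => ⟨hf x hx, fun y hxy => ?_⟩⟩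
  exact (hee x hx y hxy).trans (he x hx y hxy)

/-- Every 2-connected sparse graph of maximum degree 3 is 4-total-colourable,
and the precolouring `a ↦ 0, b ↦ 0, au ↦ 1, ub ↦ 2` around a degree-2 vertex
`u` with degree-3 neighbours `a, b` extends to a 4-total-colouring. -/
theorem stmt13 {V : Type} [Fintype V] (G : SimpleGraph V) (h2c : TwoConnected G)
    (hsp : Sparse G) (hdeg : ∀ v, (G.neighborSet v).ncard ≤ 3) :
    TotalColourable G 4 ∧
    ∀ u a b : V, a ≠ b → G.Adj a u → G.Adj u b →
      (G.neighborSet u).ncard = 2 → (G.neighborSet a).ncard = 3 →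
      (G.neighborSet b).ncard = 3 →
      ∃ (fv : V → Fin 4) (fe : Sym2 V → Fin 4), IsTotalColouring G fv fe ∧
        fv a = 0 ∧ fv b = 0 ∧ fe s(a, u) = 1 ∧ fe s(u, b) = 2 := by
  classical
  obtain ⟨c, hout, hin⟩ := exists_arc_colouring G 3 hdeg
  refine ⟨?_, fun u a b hab hau hub _ ha hb => ?_⟩
  · obtain ⟨fv, fe, h, -⟩ := exists_isTotalColouring_of_arc_colouring hsp c hout hin
    exact ⟨fv, fe, h⟩
  · obtain ⟨π, hπa, hπb⟩ := exists_perm_apply_eq_zero_one (c a u) (c b u)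
      fun h => hab (hin u a b hau hub.symm h)
    obtain ⟨fv, fe, h, hD⟩ := exists_isTotalColouring_of_arc_colouring hsp
      (fun x y => π (c x y)) (fun x y z hy hz h => hout x y z hy hz (π.injective h))
      (fun x y z hy hz h => hin x y z hy hz (π.injective h))
    refine ⟨fv, fe, h, (hD a ha.ge).1, (hD b hb.ge).1, ?_, ?_⟩
    · rw [(hD a ha.ge).2 u hau, hπa]
      rfl
    · rw [Sym2.eq_swap, (hD b hb.ge).2 u hub.symm, hπb]
      rfl
end

section
/- Every 2-connected 2-extension of the Petersen graph or of the Heawood graph is 4-total-colourable; moreover, if u is a degree-2 vertex with both neighbours a, b of degree 3, then the precolouring a ↦ 1, b ↦ 1, au ↦ 2, ub ↦ 3 extends to a 4-total-colouring. -/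
open SimpleGraph

/-- A total colouring with four colours, the edges being coloured by a symmetric function
of their endpoints. -/
structure IsPairColouring {V : Type} (G : SimpleGraph V) (fv : V → Fin 4)
    (f : V → V → Fin 4) : Prop where
  symm : ∀ u v, f u v = f v u
  vertex : ∀ u v, G.Adj u v → fv u ≠ fv v
  incident : ∀ u v, G.Adj u v → fv u ≠ f u v
  edge : ∀ u v w, G.Adj u v → G.Adj u w → v ≠ w → f u v ≠ f u w

/-- The colours of the path `v u w` prevent recolouring its interior after one subdivision. -/
def Blocked {V : Type} (fv : V → Fin 4) (f : V → V → Fin 4) (u v w : V) : Prop :=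
  fv v = f u w ∧ fv w = f u v

instance {V : Type} (fv : V → Fin 4) (f : V → V → Fin 4) (u v w : V) :
    Decidable (Blocked fv f u v w) := inferInstanceAs (Decidable (_ ∧ _))

/-- A colouring in which no branch of length two is blocked. -/
def IsFlexible {V : Type} (G : SimpleGraph V) (fv : V → Fin 4) (f : V → V → Fin 4) : Prop :=
  IsPairColouring G fv f ∧ ∀ u v w, G.Adj u v → G.Adj u w → v ≠ w →
    (G.neighborSet u).ncard = 2 → (G.neighborSet v).ncard ≠ 2 → (G.neighborSet w).ncard ≠ 2 →
    ¬ Blocked fv f u v w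

/-- `G` has a flexible colouring, and for each branch `a u b` of length two one in which `a`
and `b` share their colour. -/
def FlexiblyColourable {V : Type} (G : SimpleGraph V) : Prop :=
  (∃ fv f, IsFlexible G fv f) ∧ ∀ u a b, G.Adj u a → G.Adj u b → a ≠ b →
    (G.neighborSet u).ncard = 2 → (G.neighborSet a).ncard ≠ 2 → (G.neighborSet b).ncard ≠ 2 →
    ∃ fv f, IsFlexible G fv f ∧ fv a = fv b

/-- `t` is one of `v`, `w` or adjacent to one of them. -/
def Near {V : Type} (G : SimpleGraph V) (t v w : V) : Prop :=
  t = v ∨ t = w ∨ G.Adj v t ∨ G.Adj w t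

instance {V : Type} [DecidableEq V] (G : SimpleGraph V) [DecidableRel G.Adj] (t v w : V) :
    Decidable (Near G t v w) := inferInstanceAs (Decidable (_ ∨ _ ∨ _ ∨ _))

/-- A colouring of a cubic graph whose restriction to the complement of `S` is flexible. -/
def IsFlexibleOff {V : Type} (G : SimpleGraph V) (S : Set V) (fv : V → Fin 4)
    (f : V → V → Fin 4) : Prop :=
  IsPairColouring G fv f ∧ ∀ t ∈ S, ∀ u v w, G.Adj u t → G.Adj u v → G.Adj u w → v ≠ w →
    (∀ s ∈ S, ¬ Near G s v w) → ¬ Blocked fv f u v w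

/-- Whenever the path `a u b` becomes a branch of length two after deleting a set of
vertices, there is a suitable colouring giving `a` and `b` the same colour. -/
def PathColourable {V : Type} (G : SimpleGraph V) (u a b : V) : Prop :=
  ∀ S : Set V, (∃ t ∈ S, G.Adj u t) → (∀ s ∈ S, ¬ Near G s a b) →
    ∃ fv f, IsFlexibleOff G S fv f ∧ fv a = fv b

theorem near_comm {V : Type} {G : SimpleGraph V} {t v w : V} : Near G t v w ↔ Near G t w v := by
  unfold Near; tauto

theorem PathColourable.swap {V : Type} {G : SimpleGraph V} {u a b : V}
    (h : PathColourable G u a b) : PathColourable G u b a := by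
  intro S ht hS
  obtain ⟨fv, f, hf, hab⟩ := h S ht fun s hs hn => hS s hs (near_comm.1 hn)
  exact ⟨fv, f, hf, hab.symm⟩

theorem near_map {V W : Type} {G : SimpleGraph V} {H : SimpleGraph W} (σ : G ≃g H) {t v w : V} :
    Near H (σ t) (σ v) (σ w) ↔ Near G t v w := by
  simp [Near, σ.map_adj_iff]

theorem IsPairColouring.comp {V W : Type} {G : SimpleGraph V} {H : SimpleGraph W} (σ : G ≃g H)
    {fv : W → Fin 4} {f : W → W → Fin 4} (h : IsPairColouring H fv f) :
    IsPairColouring G (fun x => fv (σ x)) (fun x y => f (σ x) (σ y)) where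
  symm _ _ := h.symm _ _
  vertex _ _ huv := h.vertex _ _ (σ.map_adj_iff.2 huv)
  incident _ _ huv := h.incident _ _ (σ.map_adj_iff.2 huv)
  edge _ _ _ huv huw hne := h.edge _ _ _ (σ.map_adj_iff.2 huv) (σ.map_adj_iff.2 huw)
    (σ.injective.ne hne)

theorem PathColourable.of_map {V : Type} {G : SimpleGraph V} (σ : G ≃g G) {u a b : V}
    (h : PathColourable G (σ u) (σ a) (σ b)) : PathColourable G u a b := by
  rintro S ⟨t, htS, hut⟩ hS
  obtain ⟨fv, f, ⟨hc, hb⟩, hab⟩ := h (σ '' S) ⟨σ t, ⟨t, htS, rfl⟩, σ.map_adj_iff.2 hut⟩ (by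
    rintro _ ⟨s, hs, rfl⟩ hn
    exact hS s hs ((near_map σ).1 hn))
  refine ⟨_, _, ⟨hc.comp σ, ?_⟩, hab⟩
  intro t ht x v w hxt hxv hxw hne hfar
  refine hb (σ t) ⟨t, ht, rfl⟩ (σ x) (σ v) (σ w) (σ.map_adj_iff.2 hxt) (σ.map_adj_iff.2 hxv)
    (σ.map_adj_iff.2 hxw) (σ.injective.ne hne) ?_
  rintro _ ⟨s, hs, rfl⟩ hn
  exact hfar s hs ((near_map σ).1 hn)

theorem PathColourable.of_iterate {V : Type} {G : SimpleGraph V} (σ : G ≃g G) (n : ℕ) {u a b : V}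
    (h : PathColourable G (σ^[n] u) (σ^[n] a) (σ^[n] b)) : PathColourable G u a b := by
  induction n generalizing u a b with
  | zero => exact h
  | succ n ih => exact PathColourable.of_map σ (ih h)

/-- Two colourings suffice for a path if no two of their blocked branches can occur together
with the path. -/
theorem pathColourable_of_two {V : Type} {G : SimpleGraph V} {u t a b : V}
    (nb : V → Fin 3 → V) (hnb : ∀ x y, G.Adj x y → ∃ k, nb x k = y)
    (hut : ∀ t', G.Adj u t' → t' = t ∨ Near G t' a b)
    {fv gv : V → Fin 4} {f g : V → V → Fin 4}
    (hf : IsPairColouring G fv f) (hg : IsPairColouring G gv g)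
    (hfab : fv a = fv b) (hgab : gv a = gv b)
    (hconf : ∀ x i j, i ≠ j → Blocked fv f x (nb x i) (nb x j) →
      ¬ Near G t (nb x i) (nb x j) → ∀ k, ¬ Near G (nb x k) a b →
      ¬ Near G (nb x k) (nb x i) (nb x j) →
      ∀ y i' j', i' ≠ j' → Blocked gv g y (nb y i') (nb y j') →
      ¬ Near G t (nb y i') (nb y j') → ¬ Near G (nb x k) (nb y i') (nb y j') →
      ∀ k', ¬ Near G (nb y k') a b → ¬ Near G (nb y k') (nb x i) (nb x j) →
      Near G (nb y k') (nb y i') (nb y j')) :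
    PathColourable G u a b := by
  rintro S ⟨t', htS, hut'⟩ hS
  obtain rfl : t' = t := (hut t' hut').resolve_right (hS t' htS)
  by_cases h1 : IsFlexibleOff G S fv f
  · exact ⟨fv, f, h1, hfab⟩
  by_cases h2 : IsFlexibleOff G S gv g
  · exact ⟨gv, g, h2, hgab⟩
  exfalso
  simp only [IsFlexibleOff, hf, hg, true_and] at h1 h2
  push Not at h1 h2
  obtain ⟨t₁, ht₁, x, v, w, hxt, hxv, hxw, hvw, hS₁, hb₁⟩ := h1
  obtain ⟨t₂, ht₂, y, v', w', hyt, hyv, hyw, hvw', hS₂, hb₂⟩ := h2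
  obtain ⟨k, rfl⟩ := hnb _ _ hxt
  obtain ⟨i, rfl⟩ := hnb _ _ hxv
  obtain ⟨j, rfl⟩ := hnb _ _ hxw
  obtain ⟨k', rfl⟩ := hnb _ _ hyt
  obtain ⟨i', rfl⟩ := hnb _ _ hyv
  obtain ⟨j', rfl⟩ := hnb _ _ hyw
  exact hS₂ _ ht₂ (hconf x i j (ne_of_apply_ne _ hvw) hb₁ (hS₁ _ htS) k (hS _ ht₁) (hS₁ _ ht₁)
    y i' j' (ne_of_apply_ne _ hvw') hb₂ (hS₂ _ htS) (hS₂ _ ht₁) k' (hS _ ht₂) (hS₁ _ ht₂))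

instance : DecidableRel petersen.Adj := fun x y => by
  unfold petersen
  rw [SimpleGraph.fromRel_adj]
  rcases x with x | x <;> rcases y with y | y <;> infer_instance

instance : DecidableRel heawood.Adj := fun x y => by
  unfold heawood
  rw [SimpleGraph.fromRel_adj]
  infer_instance

/-- The edge colouring of the Petersen graph with the given colours on the outer cycle, the
inner cycle and the spokes. -/
def petersenEdges (o n s : Fin 5 → Fin 4) : Fin 5 ⊕ Fin 5 → Fin 5 ⊕ Fin 5 → Fin 4
  | .inl i, .inl j => if j = i + 1 then o i else if i = j + 1 then o j else 0
  | .inr i, .inr j => if j = i + 2 then n i else if i = j + 2 then n j else 0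
  | .inl i, .inr j => if i = j then s i else 0
  | .inr i, .inl j => if i = j then s i else 0

/-- The three neighbours of a vertex of the Petersen graph. -/
def petersenNeighbour : Fin 5 ⊕ Fin 5 → Fin 3 → Fin 5 ⊕ Fin 5
  | .inl i => ![.inl (i + 1), .inl (i - 1), .inr i]
  | .inr i => ![.inr (i + 2), .inr (i - 2), .inl i]

theorem petersen_adj_iff : ∀ x y, petersen.Adj x y ↔ ∃ k, petersenNeighbour x k = y := by
  decide +kernel

theorem petersenNeighbour_injective : ∀ x, Function.Injective (petersenNeighbour x) := by
  decide +kernel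

instance {V : Type} [Fintype V] [DecidableEq V] (G : SimpleGraph V) [DecidableRel G.Adj]
    (fv : V → Fin 4) (f : V → V → Fin 4) : Decidable (IsPairColouring G fv f) :=
  decidable_of_iff ((∀ u v, f u v = f v u) ∧ (∀ u v, G.Adj u v → fv u ≠ fv v) ∧
      (∀ u v, G.Adj u v → fv u ≠ f u v) ∧
      ∀ u v, G.Adj u v → ∀ w, G.Adj u w → v ≠ w → f u v ≠ f u w)
    ⟨fun ⟨h₁, h₂, h₃, h₄⟩ => ⟨h₁, h₂, h₃, fun u v w huv huw => h₄ u v huv w huw⟩,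
      fun h => ⟨h.1, h.2, h.3, fun u v huv w huw => h.4 u v w huv huw⟩⟩

set_option synthInstance.maxSize 100000 in
set_option synthInstance.maxHeartbeats 0 in
theorem petersen_base : PathColourable petersen (.inl 0) (.inl 1) (.inl 4) := by
  refine pathColourable_of_two (t := .inr 0) petersenNeighbour
    (fun x y => (petersen_adj_iff x y).1) (by decide +kernel)
    (fv := Sum.elim ![3, 0, 3, 2, 0] ![1, 2, 0, 0, 1])
    (f := petersenEdges ![1, 2, 0, 1, 2] ![3, 1, 2, 2, 0] ![0, 3, 1, 3, 3])
    (gv := Sum.elim ![3, 0, 2, 1, 0] ![1, 3, 0, 0, 2])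
    (g := petersenEdges ![1, 3, 0, 3, 2] ![2, 1, 3, 3, 0] ![0, 2, 1, 2, 1])
    ?_ ?_ ?_ ?_ ?_ <;> decide +kernel

/-- Rotation of the Petersen graph. -/
def petersenRotate : petersen ≃g petersen where
  toFun := Sum.map (· + 1) (· + 1)
  invFun := Sum.map (· - 1) (· - 1)
  left_inv := by decide +kernel
  right_inv := by decide +kernel
  map_rel_iff' := by decide +kernel

/-- The automorphism of the Petersen graph exchanging the two cycles. -/
def petersenExchange : petersen ≃g petersen where
  toFun := Sum.elim (fun i => .inr (2 * i)) (fun i => .inl (2 * i))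
  invFun := Sum.elim (fun i => .inr (3 * i)) (fun i => .inl (3 * i))
  left_inv := by decide +kernel
  right_inv := by decide +kernel
  map_rel_iff' := by decide +kernel

/-- An automorphism of the Petersen graph permuting the neighbours of a vertex cyclically. -/
def petersenSpin : petersen ≃g petersen where
  toFun := Sum.elim ![.inl 0, .inl 4, .inr 4, .inr 2, .inr 0]
    ![.inl 1, .inl 3, .inr 1, .inl 2, .inr 3]
  invFun := Sum.elim ![.inl 0, .inr 0, .inr 3, .inr 1, .inl 1]
    ![.inl 4, .inr 2, .inl 3, .inr 4, .inl 2]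
  left_inv := by decide +kernel
  right_inv := by decide +kernel
  map_rel_iff' := by decide +kernel

theorem petersen_path_transitive : ∀ x i j, i ≠ j → ∃ l : Fin 3, ∃ m : Fin 2, ∃ n : Fin 5,
    let σ := fun y => petersenSpin^[l] (petersenExchange^[m] (petersenRotate^[n] y))
    σ x = .inl 0 ∧
      (σ (petersenNeighbour x i) = .inl 1 ∧ σ (petersenNeighbour x j) = .inl 4 ∨
        σ (petersenNeighbour x i) = .inl 4 ∧ σ (petersenNeighbour x j) = .inl 1) := by
  decide +kernel

theorem petersen_pathColourable {u a b : Fin 5 ⊕ Fin 5} (ha : petersen.Adj u a)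
    (hb : petersen.Adj u b) (hab : a ≠ b) : PathColourable petersen u a b := by
  obtain ⟨i, rfl⟩ := (petersen_adj_iff _ _).1 ha
  obtain ⟨j, rfl⟩ := (petersen_adj_iff _ _).1 hb
  obtain ⟨l, m, n, hu, h⟩ := petersen_path_transitive u i j (ne_of_apply_ne _ hab)
  refine .of_iterate petersenRotate n (.of_iterate petersenExchange m
    (.of_iterate petersenSpin l ?_))
  dsimp only at hu h
  rw [hu]
  rcases h with ⟨h₁, h₂⟩ | ⟨h₁, h₂⟩ <;> rw [h₁, h₂]
  · exact petersen_base
  · exact petersen_base.swap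

/-- The edge colouring of the Heawood graph with the given colours on the Hamiltonian cycle and
on the chords. -/
def heawoodEdges (c d : Fin 14 → Fin 4) (i j : Fin 14) : Fin 4 :=
  if j = i + 1 then c i else if i = j + 1 then c j else if heawood.Adj i j then d i else 0

/-- The three neighbours of a vertex of the Heawood graph. -/
def heawoodNeighbour (i : Fin 14) : Fin 3 → Fin 14 :=
  ![i + 1, i - 1, if i.val % 2 = 0 then i + 9 else i + 5]

theorem heawood_adj_iff : ∀ x y, heawood.Adj x y ↔ ∃ k, heawoodNeighbour x k = y := by
  decide +kernel

theorem heawoodNeighbour_injective : ∀ x, Function.Injective (heawoodNeighbour x) := by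
  decide +kernel

theorem heawood_base : PathColourable heawood 0 1 9 := by
  refine pathColourable_of_two (t := 13) heawoodNeighbour
    (fun x y => (heawood_adj_iff x y).1) (by decide +kernel)
    (fv := ![3, 0, 3, 1, 0, 3, 1, 3, 2, 0, 1, 2, 0, 1])
    (f := heawoodEdges ![1, 2, 0, 2, 1, 0, 2, 0, 1, 3, 0, 3, 2, 0]
      ![2, 3, 1, 3, 3, 2, 3, 1, 3, 2, 2, 1, 1, 3])
    (gv := ![3, 0, 3, 2, 0, 3, 1, 3, 1, 0, 2, 1, 0, 1])
    (g := heawoodEdges ![1, 2, 1, 3, 1, 2, 0, 2, 3, 1, 3, 2, 3, 0]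
      ![2, 3, 0, 0, 2, 0, 3, 1, 0, 2, 0, 0, 1, 2])
    ?_ ?_ ?_ ?_ ?_ <;> decide +kernel

/-- Rotation of the Heawood graph. -/
def heawoodRotate : heawood ≃g heawood where
  toFun := (· + 2)
  invFun := (· - 2)
  left_inv := by decide +kernel
  right_inv := by decide +kernel
  map_rel_iff' := by decide +kernel

/-- The reflection of the Heawood graph exchanging the two colour classes. -/
def heawoodReflect : heawood ≃g heawood where
  toFun := (1 - ·)
  invFun := (1 - ·)
  left_inv := by decide +kernel
  right_inv := by decide +kernel
  map_rel_iff' := by decide +kernel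

/-- An automorphism of the Heawood graph permuting the neighbours of a vertex cyclically. -/
def heawoodSpin : heawood ≃g heawood where
  toFun := ![0, 13, 12, 11, 10, 5, 4, 3, 2, 1, 6, 7, 8, 9]
  invFun := ![0, 9, 8, 7, 6, 5, 10, 11, 12, 13, 4, 3, 2, 1]
  left_inv := by decide +kernel
  right_inv := by decide +kernel
  map_rel_iff' := by decide +kernel

theorem heawood_path_transitive : ∀ x i j, i ≠ j → ∃ l : Fin 3, ∃ m : Fin 2, ∃ n : Fin 7,
    let σ := fun y => heawoodSpin^[l] (heawoodReflect^[m] (heawoodRotate^[n] y))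
    σ x = 0 ∧
      (σ (heawoodNeighbour x i) = 1 ∧ σ (heawoodNeighbour x j) = 9 ∨
        σ (heawoodNeighbour x i) = 9 ∧ σ (heawoodNeighbour x j) = 1) := by
  decide +kernel

theorem heawood_pathColourable {u a b : Fin 14} (ha : heawood.Adj u a)
    (hb : heawood.Adj u b) (hab : a ≠ b) : PathColourable heawood u a b := by
  obtain ⟨i, rfl⟩ := (heawood_adj_iff _ _).1 ha
  obtain ⟨j, rfl⟩ := (heawood_adj_iff _ _).1 hb
  obtain ⟨l, m, n, hu, h⟩ := heawood_path_transitive u i j (ne_of_apply_ne _ hab)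
  refine .of_iterate heawoodRotate n (.of_iterate heawoodReflect m
    (.of_iterate heawoodSpin l ?_))
  dsimp only at hu h
  rw [hu]
  rcases h with ⟨h₁, h₂⟩ | ⟨h₁, h₂⟩ <;> rw [h₁, h₂]
  · exact heawood_base
  · exact heawood_base.swap

theorem ncard_neighborSet_induce {V : Type} (G : SimpleGraph V) (S : Set V) (x : (Sᶜ : Set V)) :
    ((G.induce Sᶜ).neighborSet x).ncard = (G.neighborSet x \ S).ncard := by
  rw [← Set.ncard_image_of_injective _ Subtype.val_injective]
  congr 1
  ext y
  simp only [Set.mem_image, mem_neighborSet, comap_adj, Function.Embedding.subtype_apply,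
    Subtype.exists, Set.mem_compl_iff, exists_and_left, exists_prop, exists_eq_right_right,
    Set.mem_sdiff]

theorem flexiblyColourable_induce {V : Type} [Finite V] (G : SimpleGraph V)
    (hcubic : ∀ x, (G.neighborSet x).ncard = 3)
    (hpath : ∀ u a b, G.Adj u a → G.Adj u b → a ≠ b → PathColourable G u a b)
    (hcol : ∃ fv f, IsPairColouring G fv f) (S : Set V)
    (hdeg : ∀ x, 2 ≤ ((G.induce Sᶜ).neighborSet x).ncard) :
    FlexiblyColourable (G.induce Sᶜ) := by
  have hfull : ∀ v : (Sᶜ : Set V), ((G.induce Sᶜ).neighborSet v).ncard ≠ 2 →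
      ∀ t ∈ S, ¬ G.Adj v t := by
    intro v hv t ht hvt
    have h2 := hdeg v
    rw [ncard_neighborSet_induce] at hv h2
    have hlt : (G.neighborSet v \ S).ncard < (G.neighborSet v).ncard :=
      Set.ncard_lt_ncard (Set.sdiff_ssubset_left_iff.2 ⟨t, hvt, ht⟩)
    have := hcubic v
    omega
  have hfar : ∀ v w : (Sᶜ : Set V), ((G.induce Sᶜ).neighborSet v).ncard ≠ 2 →
      ((G.induce Sᶜ).neighborSet w).ncard ≠ 2 → ∀ s ∈ S, ¬ Near G s v w := by
    rintro v w hv hw s hs (rfl | rfl | h | h)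
    exacts [v.2 hs, w.2 hs, hfull v hv s hs h, hfull w hw s hs h]
  have hmiss : ∀ u : (Sᶜ : Set V), ((G.induce Sᶜ).neighborSet u).ncard = 2 →
      ∃ t ∈ S, G.Adj u t := by
    intro u hu
    by_contra! h
    have hdisj : Disjoint (G.neighborSet u) S := Set.disjoint_left.2 fun t ht hS => h t hS ht
    rw [ncard_neighborSet_induce, hdisj.sdiff_eq_left, hcubic] at hu
    omega
  have hrestrict : ∀ fv f, IsPairColouring G fv f →
      IsPairColouring (G.induce Sᶜ) (fun x => fv x) (fun x y => f x y) := fun fv f h =>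
    ⟨fun _ _ => h.symm _ _, fun _ _ huv => h.vertex _ _ huv, fun _ _ huv => h.incident _ _ huv,
      fun _ _ _ huv huw hne => h.edge _ _ _ huv huw (Subtype.coe_ne_coe.2 hne)⟩
  have hbranch : ∀ u a b, (G.induce Sᶜ).Adj u a → (G.induce Sᶜ).Adj u b → a ≠ b →
      ((G.induce Sᶜ).neighborSet u).ncard = 2 → ((G.induce Sᶜ).neighborSet a).ncard ≠ 2 →
      ((G.induce Sᶜ).neighborSet b).ncard ≠ 2 →
      ∃ fv f, IsFlexible (G.induce Sᶜ) fv f ∧ fv a = fv b := by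
    intro u a b hua hub hab hu ha hb
    obtain ⟨fv, f, ⟨hc, hf⟩, hfab⟩ := hpath u a b hua hub (Subtype.coe_ne_coe.2 hab) S
      (hmiss u hu) (hfar a b ha hb)
    refine ⟨_, _, ⟨hrestrict fv f hc, ?_⟩, hfab⟩
    intro x v w hxv hxw hvw hx hv hw
    obtain ⟨t, ht, hxt⟩ := hmiss x hx
    exact hf t ht x v w hxt hxv hxw (Subtype.coe_ne_coe.2 hvw) (hfar v w hv hw)
  refine ⟨?_, hbranch⟩
  by_contra hno
  obtain ⟨fv, f, hc⟩ := hcol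
  refine hno ⟨_, _, hrestrict fv f hc, fun u v w huv huw hvw hu hv hw => ?_⟩
  obtain ⟨fv', f', hf', -⟩ := hbranch u v w huv huw hvw hu hv hw
  exact (hno ⟨fv', f', hf'⟩).elim

theorem ncard_neighborSet_of_parametrisation {V : Type} {G : SimpleGraph V} (nb : V → Fin 3 → V)
    (hnb : ∀ x y, G.Adj x y ↔ ∃ k, nb x k = y) (hinj : ∀ x, Function.Injective (nb x)) (x : V) :
    (G.neighborSet x).ncard = 3 := by
  have : G.neighborSet x = Set.range (nb x) := by
    ext y
    simp [hnb]
  rw [this, ← Set.image_univ, Set.ncard_image_of_injective _ (hinj x), Set.ncard_univ, Nat.card_fin]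

theorem petersen_induce_flexiblyColourable (S : Set (Fin 5 ⊕ Fin 5))
    (hdeg : ∀ x, 2 ≤ ((petersen.induce Sᶜ).neighborSet x).ncard) :
    FlexiblyColourable (petersen.induce Sᶜ) :=
  flexiblyColourable_induce _
    (ncard_neighborSet_of_parametrisation _ petersen_adj_iff petersenNeighbour_injective)
    (fun _ _ _ => petersen_pathColourable)
    ⟨Sum.elim ![3, 0, 3, 2, 0] ![1, 2, 0, 0, 1],
      petersenEdges ![1, 2, 0, 1, 2] ![3, 1, 2, 2, 0] ![0, 3, 1, 3, 3], by decide +kernel⟩ S hdeg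

theorem heawood_induce_flexiblyColourable (S : Set (Fin 14))
    (hdeg : ∀ x, 2 ≤ ((heawood.induce Sᶜ).neighborSet x).ncard) :
    FlexiblyColourable (heawood.induce Sᶜ) :=
  flexiblyColourable_induce _
    (ncard_neighborSet_of_parametrisation _ heawood_adj_iff heawoodNeighbour_injective)
    (fun _ _ _ => heawood_pathColourable)
    ⟨![3, 0, 3, 1, 0, 3, 1, 3, 2, 0, 1, 2, 0, 1],
      heawoodEdges ![1, 2, 0, 2, 1, 0, 2, 0, 1, 3, 0, 3, 2, 0]
        ![2, 3, 1, 3, 3, 2, 3, 1, 3, 2, 2, 1, 1, 3], by decide +kernel⟩ S hdeg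

theorem ncard_neighborSet_iso {V W : Type} {G : SimpleGraph V} {H : SimpleGraph W} (σ : G ≃g H)
    (x : V) : (H.neighborSet (σ x)).ncard = (G.neighborSet x).ncard := by
  rw [← Set.ncard_image_of_injective (G.neighborSet x) σ.injective]
  congr 1
  ext y
  obtain ⟨y, rfl⟩ := σ.surjective y
  simp [σ.map_adj_iff]

theorem IsFlexible.comp {V W : Type} {G : SimpleGraph V} {H : SimpleGraph W} (σ : G ≃g H)
    {fv : W → Fin 4} {f : W → W → Fin 4} (h : IsFlexible H fv f) :
    IsFlexible G (fun x => fv (σ x)) (fun x y => f (σ x) (σ y)) := by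
  refine ⟨h.1.comp σ, fun u v w huv huw hvw hu hv hw => ?_⟩
  rw [← ncard_neighborSet_iso σ] at hu hv hw
  exact h.2 _ _ _ (σ.map_adj_iff.2 huv) (σ.map_adj_iff.2 huw) (σ.injective.ne hvw) hu hv hw

theorem FlexiblyColourable.iso {V W : Type} {G : SimpleGraph V} {H : SimpleGraph W} (σ : G ≃g H)
    (h : FlexiblyColourable H) : FlexiblyColourable G := by
  obtain ⟨⟨fv, f, hf⟩, h⟩ := h
  refine ⟨⟨_, _, hf.comp σ⟩, fun u a b hua hub hab hu ha hb => ?_⟩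
  rw [← ncard_neighborSet_iso σ] at hu ha hb
  obtain ⟨fv, f, hf, hfab⟩ := h _ _ _ (σ.map_adj_iff.2 hua) (σ.map_adj_iff.2 hub)
    (σ.injective.ne hab) hu ha hb
  exact ⟨_, _, hf.comp σ, hfab⟩

section Subdivision

variable {V : Type} {G : SimpleGraph V} {u v : V}

theorem subdivideEdge_adj_inl_inl {a b : V} :
    (SubdivideEdge G u v).Adj (.inl a) (.inl b) ↔ G.Adj a b ∧ s(a, b) ≠ s(u, v) := by
  simp only [SubdivideEdge, SimpleGraph.fromRel_adj, G.adj_comm b a, Sym2.eq_swap (a := b), or_self]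
  exact ⟨fun h => h.2, fun h => ⟨fun e => h.1.ne (Sum.inl_injective e), h⟩⟩

theorem subdivideEdge_adj_inl_inr {a : V} {x : Unit} :
    (SubdivideEdge G u v).Adj (.inl a) (.inr x) ↔ a = u ∨ a = v := by
  simp [SubdivideEdge]

theorem subdivideEdge_adj_inr_inl {a : V} {x : Unit} :
    (SubdivideEdge G u v).Adj (.inr x) (.inl a) ↔ a = u ∨ a = v := by
  rw [SimpleGraph.adj_comm, subdivideEdge_adj_inl_inr]

theorem subdivideEdge_swap : SubdivideEdge G u v = SubdivideEdge G v u := by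
  ext (a | a) (b | b)
  · rw [subdivideEdge_adj_inl_inl, subdivideEdge_adj_inl_inl, Sym2.eq_swap (a := u)]
  · rw [subdivideEdge_adj_inl_inr, subdivideEdge_adj_inl_inr, or_comm]
  · rw [subdivideEdge_adj_inr_inl, subdivideEdge_adj_inr_inl, or_comm]
  · exact iff_of_false (SimpleGraph.irrefl _) (SimpleGraph.irrefl _)

theorem ncard_neighborSet_subdivideEdge_inr (huv : G.Adj u v) (x : Unit) :
    ((SubdivideEdge G u v).neighborSet (.inr x)).ncard = 2 := by
  have : (SubdivideEdge G u v).neighborSet (.inr x) = {.inl u, .inl v} := by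
    ext (a | a)
    · simp [subdivideEdge_adj_inr_inl]
    · simp
  rw [this, Set.ncard_pair (Sum.inl_injective.ne huv.ne)]

theorem ncard_neighborSet_subdivideEdge_inl (huv : G.Adj u v) (a : V) :
    ((SubdivideEdge G u v).neighborSet (.inl a)).ncard = (G.neighborSet a).ncard := by
  classical
  have : (SubdivideEdge G u v).neighborSet (.inl a) =
      (fun b => if s(a, b) = s(u, v) then .inr () else .inl b) '' G.neighborSet a := by
    ext (b | b)
    · simp only [mem_neighborSet, subdivideEdge_adj_inl_inl, Set.mem_image]
      constructor
      · exact fun h => ⟨b, h.1, if_neg h.2⟩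
      · rintro ⟨c, hc, h⟩
        split_ifs at h with hs
        cases h
        exact ⟨hc, hs⟩
    · simp only [mem_neighborSet, subdivideEdge_adj_inl_inr, Set.mem_image]
      constructor
      · rintro (rfl | rfl)
        · exact ⟨v, huv, if_pos rfl⟩
        · exact ⟨u, huv.symm, if_pos Sym2.eq_swap⟩
      · rintro ⟨c, hc, h⟩
        split_ifs at h with hs
        rcases Sym2.eq_iff.1 hs with h | h
        exacts [.inl h.1, .inr h.1]
  rw [this, Set.ncard_image_of_injective]
  intro b c h
  dsimp only at h
  split_ifs at h with h₁ h₂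
  · exact Sym2.congr_right.1 (h₁.trans h₂.symm)
  · exact Sum.inl_injective h

/-- A colouring of a subdivision agreeing with a flexible one away from the vertices of degree
two is flexible. -/
theorem IsFlexible.subdivideEdge (huv : G.Adj u v)
    (hu : (G.neighborSet u).ncard = 2) {fv : V → Fin 4} {f : V → V → Fin 4}
    (h : IsFlexible G fv f) {gv : V ⊕ Unit → Fin 4} {g : V ⊕ Unit → V ⊕ Unit → Fin 4}
    (hc : IsPairColouring (SubdivideEdge G u v) gv g)
    (hgv : ∀ a, (G.neighborSet a).ncard ≠ 2 → gv (.inl a) = fv a)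
    (hg : ∀ a b, G.Adj a b → (G.neighborSet b).ncard ≠ 2 → g (.inl a) (.inl b) = f a b) :
    IsFlexible (SubdivideEdge G u v) gv g := by
  refine ⟨hc, ?_⟩
  rintro (x | x) (y | y) (z | z) hxy hxz hyz hx hy hz
  · rw [subdivideEdge_adj_inl_inl] at hxy hxz
    rw [ncard_neighborSet_subdivideEdge_inl huv] at hx hy hz
    rw [Blocked, hgv y hy, hgv z hz, hg x y hxy.1 hy, hg x z hxz.1 hz]
    exact h.2 x y z hxy.1 hxz.1 (ne_of_apply_ne _ hyz) hx hy hz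
  all_goals
    exfalso
    simp_all [ncard_neighborSet_subdivideEdge_inr huv, subdivideEdge_adj_inr_inl,
      ncard_neighborSet_subdivideEdge_inl huv]
  grind

/-- The edge colours of a subdivision: `p` and `q` on the two new edges, `f` elsewhere. -/
def subdivisionEdges {V : Type} [DecidableEq V] (u : V) (f : V → V → Fin 4) (p q : Fin 4) :
    V ⊕ Unit → V ⊕ Unit → Fin 4
  | .inl a, .inl b => f a b
  | .inl a, .inr _ => if a = u then p else q
  | .inr _, .inl a => if a = u then p else q
  | .inr _, .inr _ => 0

theorem isPairColouring_subdivideEdge [DecidableEq V] (huv : G.Adj u v) {fv : V → Fin 4}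
    {f : V → V → Fin 4} {x p q : Fin 4} (symm : ∀ a b, f a b = f b a)
    (vertex : ∀ a b, G.Adj a b → s(a, b) ≠ s(u, v) → fv a ≠ fv b)
    (incident : ∀ a b, G.Adj a b → s(a, b) ≠ s(u, v) → fv a ≠ f a b)
    (edge : ∀ a b c, G.Adj a b → G.Adj a c → b ≠ c → s(a, b) ≠ s(u, v) → s(a, c) ≠ s(u, v) →
      f a b ≠ f a c)
    (hxu : x ≠ fv u) (hxv : x ≠ fv v) (hxp : x ≠ p) (hxq : x ≠ q) (hpq : p ≠ q)
    (hup : fv u ≠ p) (hvq : fv v ≠ q) (hp : ∀ b, G.Adj u b → b ≠ v → f u b ≠ p)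
    (hq : ∀ b, G.Adj v b → b ≠ u → f v b ≠ q) :
    IsPairColouring (SubdivideEdge G u v) (Sum.elim fv fun _ => x)
      (subdivisionEdges u f p q) where
  symm := by
    rintro (a | a) (b | b) <;> simp [subdivisionEdges, symm]
  vertex := by
    rintro (a | a) (b | b) hab <;>
      simp only [subdivideEdge_adj_inl_inl, subdivideEdge_adj_inl_inr, subdivideEdge_adj_inr_inl,
        SimpleGraph.irrefl, Sum.elim_inl, Sum.elim_inr] at hab ⊢ <;> grind
  incident := by
    have := huv.ne
    rintro (a | a) (b | b) hab <;>
      simp only [subdivideEdge_adj_inl_inl, subdivideEdge_adj_inl_inr, subdivideEdge_adj_inr_inl,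
        SimpleGraph.irrefl, Sum.elim_inl, Sum.elim_inr, subdivisionEdges] at hab ⊢ <;> grind
  edge := by
    have := huv.ne
    rintro (a | a) (b | b) (c | c) hab hac hbc <;>
      simp only [subdivideEdge_adj_inl_inl, subdivideEdge_adj_inl_inr, subdivideEdge_adj_inr_inl,
        SimpleGraph.irrefl, subdivisionEdges, ne_eq, Sum.inl.injEq, not_true] at hab hac hbc ⊢ <;>
      grind

set_option synthInstance.maxSize 100000 in
set_option synthInstance.maxHeartbeats 0 in
theorem exists_colours_of_length_three : ∀ A B p q : Fin 4, A ≠ p → B ≠ q → p ≠ q →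
    ¬ (A = q ∧ B = p) → ∃ y m x : Fin 4, y ≠ A ∧ y ≠ p ∧ m ≠ p ∧ m ≠ y ∧ x ≠ y ∧ x ≠ m ∧ m ≠ q ∧
      x ≠ q ∧ x ≠ B := by
  decide +kernel

set_option synthInstance.maxSize 100000 in
set_option synthInstance.maxHeartbeats 0 in
theorem exists_colours_of_length_four : ∀ A B p q : Fin 4, A ≠ p → B ≠ q →
    ∃ y m x n z : Fin 4, y ≠ A ∧ y ≠ p ∧ m ≠ p ∧ m ≠ y ∧ x ≠ y ∧ x ≠ m ∧ n ≠ m ∧ n ≠ x ∧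
      z ≠ x ∧ z ≠ n ∧ n ≠ q ∧ z ≠ q ∧ z ≠ B := by
  decide +kernel

theorem exists_neighbour_of_ncard_eq_two (huv : G.Adj u v) (hu : (G.neighborSet u).ncard = 2) :
    ∃ w, w ≠ v ∧ ∀ t, G.Adj u t ↔ t = v ∨ t = w := by
  obtain ⟨x, y, hxy, h⟩ := Set.ncard_eq_two.1 hu
  simp only [Set.ext_iff, mem_neighborSet, Set.mem_insert_iff, Set.mem_singleton_iff] at h
  rcases (h v).1 huv with rfl | rfl
  · exact ⟨y, hxy.symm, h⟩
  · exact ⟨x, hxy, fun t => (h t).trans or_comm⟩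

theorem exists_isPairColouring_subdivideEdge (huv : G.Adj u v)
    (hu : (G.neighborSet u).ncard = 2) {fv : V → Fin 4} {f : V → V → Fin 4}
    (h : IsFlexible G fv f) :
    ∃ gv g, IsPairColouring (SubdivideEdge G u v) gv g ∧
      (∀ a, (G.neighborSet a).ncard ≠ 2 → gv (.inl a) = fv a) ∧
      ∀ a b, G.Adj a b → (G.neighborSet b).ncard ≠ 2 → g (.inl a) (.inl b) = f a b := by
  classical
  obtain ⟨w, hwv, hN⟩ := exists_neighbour_of_ncard_eq_two huv hu
  have huw : G.Adj u w := (hN w).2 (.inr rfl)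
  obtain ⟨⟨symm, vertex, incident, edge⟩, hflex⟩ := h
  have hne := huv.ne
  have hne' := huw.ne
  have hadj : ∀ a b, G.Adj a b → G.Adj b a := fun _ _ h => h.symm
  have hblocked : ¬ (G.neighborSet w).ncard = 2 → ¬ (G.neighborSet v).ncard = 2 →
      ¬ (fv w = f u v ∧ fv v = f w u) := fun hw hv => symm u w ▸ hflex u w v huw huv hwv hu hw hv
  clear hflex
  by_cases hv : (G.neighborSet v).ncard = 2
  · obtain ⟨z, hzu, hNv⟩ := exists_neighbour_of_ncard_eq_two huv.symm hv
    have hvz : G.Adj v z := (hNv z).2 (.inr rfl)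
    obtain ⟨y, m, x, n, t, h⟩ := exists_colours_of_length_four (fv w) (fv z) (f w u) (f v z)
      (incident w u huw.symm) (symm v z ▸ incident z v hvz.symm)
    refine ⟨Sum.elim (fun a => if a = u then y else if a = v then t else fv a) fun _ => x,
      subdivisionEdges u f m n, isPairColouring_subdivideEdge huv symm ?_ ?_ ?_ ?_ ?_ ?_ ?_ ?_ ?_
        ?_ ?_ ?_, ?_, ?_⟩
    all_goals grind [subdivisionEdges]
  by_cases hw : (G.neighborSet w).ncard = 2
  · obtain ⟨z, hzu, hNw⟩ := exists_neighbour_of_ncard_eq_two huw.symm hw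
    have hwz : G.Adj w z := (hNw z).2 (.inr rfl)
    obtain ⟨y, m, x, n, t, h⟩ := exists_colours_of_length_four (fv z) (fv v) (f z w) (f u v)
      (incident z w hwz.symm) (symm u v ▸ incident v u huv.symm)
    refine ⟨Sum.elim (fun a => if a = w then y else if a = u then x else fv a) fun _ => t,
      subdivisionEdges u (fun a b => if s(a, b) = s(w, u) then m else f a b) n (f u v),
      isPairColouring_subdivideEdge huv ?_ ?_ ?_ ?_ ?_ ?_ ?_ ?_ ?_
        ?_ ?_ ?_ ?_, ?_, ?_⟩
    all_goals grind [subdivisionEdges]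
  obtain ⟨y, m, x, h⟩ := exists_colours_of_length_three (fv w) (fv v) (f w u) (f u v)
    (incident w u huw.symm) (symm u v ▸ incident v u huv.symm)
    (symm u w ▸ edge u w v huw huv hwv)
    (hblocked hw hv)
  refine ⟨Sum.elim (fun a => if a = u then y else fv a) fun _ => x,
    subdivisionEdges u f m (f u v), isPairColouring_subdivideEdge huv symm ?_ ?_ ?_ ?_ ?_ ?_ ?_
      ?_ ?_ ?_ ?_ ?_, ?_, ?_⟩
  all_goals grind [subdivisionEdges]

theorem FlexiblyColourable.subdivideEdge (huv : G.Adj u v) (hu : (G.neighborSet u).ncard = 2)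
    (h : FlexiblyColourable G) : FlexiblyColourable (SubdivideEdge G u v) := by
  obtain ⟨⟨fv, f, hf⟩, h⟩ := h
  constructor
  · obtain ⟨gv, g, hc, hgv, hg⟩ := exists_isPairColouring_subdivideEdge huv hu hf
    exact ⟨gv, g, hf.subdivideEdge huv hu hc hgv hg⟩
  rintro (x | x) (a | a) (b | b) hxa hxb hab hx ha hb
  · rw [subdivideEdge_adj_inl_inl] at hxa hxb
    rw [ncard_neighborSet_subdivideEdge_inl huv] at hx ha hb
    obtain ⟨fv, f, hf, hfab⟩ := h x a b hxa.1 hxb.1 (ne_of_apply_ne _ hab) hx ha hb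
    obtain ⟨gv, g, hc, hgv, hg⟩ := exists_isPairColouring_subdivideEdge huv hu hf
    exact ⟨gv, g, hf.subdivideEdge huv hu hc hgv hg, by rw [hgv a ha, hgv b hb, hfab]⟩
  all_goals
    exfalso
    simp_all [ncard_neighborSet_subdivideEdge_inr huv, subdivideEdge_adj_inr_inl,
      ncard_neighborSet_subdivideEdge_inl huv]
  grind

end Subdivision

theorem IsSubdivisionOf.flexiblyColourable {V W : Type} {H : SimpleGraph W} {G : SimpleGraph V}
    (h : IsSubdivisionOf H G)
    (hH : (∀ x, 2 ≤ (H.neighborSet x).ncard) → FlexiblyColourable H)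
    (hG : ∀ x, 2 ≤ (G.neighborSet x).ncard) : FlexiblyColourable G := by
  induction h with
  | refl G σ =>
    refine (hH fun x => ?_).iso σ
    rw [← ncard_neighborSet_iso σ.symm]
    exact hG _
  | step G u v huv hdeg _ G' σ ih =>
    have h : FlexiblyColourable G := ih fun x => by
      rw [← ncard_neighborSet_subdivideEdge_inl huv, ← ncard_neighborSet_iso σ.symm]
      exact hG _
    rcases hdeg with hu | hv
    · exact (h.subdivideEdge huv hu).iso σ
    · rw [subdivideEdge_swap] at σ
      exact (h.subdivideEdge huv.symm hv).iso σ

theorem TwoConnected.two_le_ncard_neighborSet {V : Type} [Finite V] {G : SimpleGraph V}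
    (h : TwoConnected G) (v : V) : 2 ≤ (G.neighborSet v).ncard := by
  by_contra! hlt
  obtain ⟨x, hx⟩ : ∃ x, x ≠ v ∧ G.neighborSet v ⊆ {x} := by
    rcases (Set.ncard_le_one_iff_eq (Set.toFinite _)).1 (Nat.le_of_lt_succ hlt) with h0 | ⟨x, hx⟩
    · have : 1 < (Set.univ : Set V).ncard := by have := h.1; omega
      obtain ⟨x, -, hxv⟩ := Set.exists_ne_of_one_lt_ncard this v
      exact ⟨x, hxv, h0 ▸ Set.empty_subset _⟩
    · exact ⟨x, (G.ne_of_adj (hx ▸ rfl : x ∈ G.neighborSet v)).symm, hx.subset⟩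
  obtain ⟨y, -, hy⟩ : ∃ y ∈ (Set.univ : Set V), y ∉ ({v, x} : Set V) := by
    refine Set.exists_mem_notMem_of_ncard_lt_ncard ?_
    have := Set.ncard_pair hx.1.symm
    have := h.1
    omega
  simp only [Set.mem_insert_iff, Set.mem_singleton_iff, not_or] at hy
  have hconn := (h.2 x).preconnected
  have : Nontrivial ({x}ᶜ : Set V) :=
    ⟨⟨v, hx.1.symm⟩, ⟨y, hy.2⟩, fun e => hy.1 (Subtype.ext_iff.1 e).symm⟩
  obtain ⟨z, hz⟩ := hconn.exists_adj_of_nontrivial ⟨v, hx.1.symm⟩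
  exact z.2 (hx.2 hz)

theorem IsPairColouring.isTotalColouring {V : Type} {G : SimpleGraph V} {fv : V → Fin 4}
    {f : V → V → Fin 4} (h : IsPairColouring G fv f) :
    IsTotalColouring G fv (Sym2.lift ⟨f, h.symm⟩) := by
  refine ⟨h.vertex, ?_, ?_⟩
  · rintro e₁ e₂ he₁ he₂ hne ⟨x, ⟨y, rfl⟩, ⟨z, rfl⟩⟩
    exact h.edge x y z he₁ he₂ (by rintro rfl; exact hne rfl)
  · rintro x e he ⟨y, rfl⟩
    exact h.incident x y he

theorem IsTotalColouring.map {V α β : Type} {G : SimpleGraph V} {fv : V → α} {fe : Sym2 V → α}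
    (h : IsTotalColouring G fv fe) {π : α → β} (hπ : Function.Injective π) :
    IsTotalColouring G (π ∘ fv) (π ∘ fe) :=
  ⟨fun u v huv => hπ.ne (h.1 u v huv),
    fun e₁ e₂ he₁ he₂ hne hx => hπ.ne (h.2.1 e₁ e₂ he₁ he₂ hne hx),
    fun x e he hx => hπ.ne (h.2.2 x e he hx)⟩

theorem exists_perm_fin_four : ∀ x y z : Fin 4, x ≠ y → x ≠ z → y ≠ z →
    ∃ π : Equiv.Perm (Fin 4), π x = 0 ∧ π y = 1 ∧ π z = 2 := by
  decide +kernel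

/-- Every 2-connected 2-extension of the Petersen or Heawood graph is
4-total-colourable; moreover the precolouring `a ↦ 0, b ↦ 0, au ↦ 1, ub ↦ 2`
around a degree-2 vertex `u` with degree-3 neighbours `a, b` extends. -/
theorem stmt15 {V : Type} [Fintype V] (G : SimpleGraph V) (h2c : TwoConnected G)
    (hext : IsTwoExtensionOf petersen G ∨ IsTwoExtensionOf heawood G) :
    TotalColourable G 4 ∧
    ∀ u a b : V, a ≠ b → G.Adj a u → G.Adj u b →
      (G.neighborSet u).ncard = 2 → (G.neighborSet a).ncard = 3 →
      (G.neighborSet b).ncard = 3 →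
      ∃ (fv : V → Fin 4) (fe : Sym2 V → Fin 4), IsTotalColouring G fv fe ∧
        fv a = 0 ∧ fv b = 0 ∧ fe s(a, u) = 1 ∧ fe s(u, b) = 2 := by
  have hG : FlexiblyColourable G := by
    have hdeg := h2c.two_le_ncard_neighborSet
    rcases hext with ⟨S, hS⟩ | ⟨S, hS⟩
    · exact hS.flexiblyColourable (petersen_induce_flexiblyColourable S) hdeg
    · exact hS.flexiblyColourable (heawood_induce_flexiblyColourable S) hdeg
  obtain ⟨⟨fv, f, hf⟩, h⟩ := hG
  refine ⟨⟨fv, _, hf.1.isTotalColouring⟩, fun u a b hab hau hub hu ha hb => ?_⟩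
  obtain ⟨fv, f, ⟨hc, -⟩, hfab⟩ := h u a b hau.symm hub hab hu (by omega) (by omega)
  obtain ⟨π, h₀, h₁, h₂⟩ := exists_perm_fin_four (fv a) (f a u) (f u b) (hc.incident a u hau)
    (by rw [hfab, hc.symm]; exact hc.incident b u hub.symm)
    (by rw [hc.symm]; exact hc.edge u a b hau.symm hub hab)
  exact ⟨_, _, hc.isTotalColouring.map π.injective, h₀, by rw [Function.comp_apply, ← hfab, h₀],
    h₁, h₂⟩
end
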